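/- arXiv:1210.3231 — 3 statements merged into one kernel-verified Lean document; each statement's English description precedes it below -/
import Mathlib

section
/- Let p be a homogeneous polynomial in d variables with real coefficients, hyperbolic in direction ξ ∈ ℝ^d, and let K(p, ξ) be the connected component of the set { x ∈ ℝ^d : p(x) ≠ 0 } that contains ξ. Then: (i) p is hyperbolic in direction x for every x ∈ K(p, ξ); (ii) K(p, ξ) is an open convex cone (closed under addition and under multiplication by positive scalars); (iii) K(p, ξ) equals the set of x ∈ ℝ^d such that every root of the univariate polynomial t ↦ p(x + t ξ) is real and strictly negative. -/
open Topology

namespace MvPolynomial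

section Factorization

variable {σ : Type*} {m : ℕ} {p : MvPolynomial σ ℝ}

theorem IsHomogeneous.aeval_smul_complex (hp : p.IsHomogeneous m) (c : ℂ) (z : σ → ℂ) :
    MvPolynomial.aeval (c • z) p = c ^ m * MvPolynomial.aeval z p := by
  simp only [aeval_def, eval₂_eq, Finset.mul_sum]
  refine Finset.sum_congr rfl fun s hs => ?_
  have hdeg : ∑ i ∈ s.support, s i = m := by
    rw [← hp (mem_support_iff.mp hs), Finsupp.weight_apply, Finsupp.sum]
    simp
  simp only [Pi.smul_apply, smul_eq_mul, mul_pow, Finset.prod_mul_distrib,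
    Finset.prod_pow_eq_pow_sum, hdeg]
  ring

/-- The restriction of a polynomial to the line through `z` with direction `w`. -/
noncomputable def linePolynomial (p : MvPolynomial σ ℝ) (z w : σ → ℂ) : Polynomial ℂ :=
  MvPolynomial.aeval (fun j => Polynomial.C (w j) * Polynomial.X + Polynomial.C (z j)) p

theorem eval_linePolynomial (z w : σ → ℂ) (μ : ℂ) :
    (linePolynomial p z w).eval μ = MvPolynomial.aeval (z + μ • w) p := by
  have key : ((Polynomial.aeval (R := ℂ) μ).restrictScalars ℝ).comp
      (MvPolynomial.aeval (fun j => Polynomial.C (w j) * Polynomial.X + Polynomial.C (z j))) =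
      (MvPolynomial.aeval (z + μ • w) : MvPolynomial σ ℝ →ₐ[ℝ] ℂ) := by
    ext j
    simp only [AlgHom.comp_apply, AlgHom.restrictScalars_apply, aeval_X, map_add, map_mul,
      Polynomial.aeval_C, Polynomial.aeval_X, Algebra.algebraMap_self, RingHom.id_apply,
      Pi.add_apply, Pi.smul_apply, smul_eq_mul]
    ring
  rw [linePolynomial, ← key, AlgHom.comp_apply, AlgHom.restrictScalars_apply,
    Polynomial.coe_aeval_eq_eval]

theorem natDegree_prod_linear_pow_le_and_coeff (z w : σ → ℂ) (e : σ → ℕ) (s : Finset σ) :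
    (∏ j ∈ s, (Polynomial.C (w j) * Polynomial.X + Polynomial.C (z j)) ^ e j).natDegree
        ≤ ∑ j ∈ s, e j ∧
      (∏ j ∈ s, (Polynomial.C (w j) * Polynomial.X + Polynomial.C (z j)) ^ e j).coeff
        (∑ j ∈ s, e j) = ∏ j ∈ s, w j ^ e j := by
  classical
  induction s using Finset.induction_on with
  | empty => simp
  | insert a s ha ih =>
    rw [Finset.prod_insert ha, Finset.sum_insert ha, Finset.prod_insert ha]
    have hlin : (Polynomial.C (w a) * Polynomial.X + Polynomial.C (z a)).natDegree ≤ 1 :=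
      Polynomial.natDegree_linear_le
    have hpow : ((Polynomial.C (w a) * Polynomial.X + Polynomial.C (z a)) ^ e a).natDegree
        ≤ e a := by
      simpa using Polynomial.natDegree_pow_le_of_le (e a) hlin
    refine ⟨Polynomial.natDegree_mul_le_of_le hpow ih.1, ?_⟩
    rw [Polynomial.coeff_mul_add_eq_of_natDegree_le hpow ih.1, ih.2]
    have h := Polynomial.coeff_pow_of_natDegree_le (m := e a) hlin
    rw [mul_one] at h
    rw [h]
    simp

theorem IsHomogeneous.natDegree_linePolynomial_le_and_coeff (hp : p.IsHomogeneous m)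
    (z w : σ → ℂ) :
    (linePolynomial p z w).natDegree ≤ m ∧ (linePolynomial p z w).coeff m = MvPolynomial.aeval w p := by
  have hdeg : ∀ s ∈ p.support, ∑ i ∈ s.support, s i = m := fun s hs => by
    rw [← hp (mem_support_iff.mp hs), Finsupp.weight_apply, Finsupp.sum]
    simp
  simp only [linePolynomial, aeval_def, eval₂_eq, IsScalarTower.algebraMap_apply ℝ ℂ
    (Polynomial ℂ), Polynomial.algebraMap_eq]
  constructor
  · refine Polynomial.natDegree_sum_le_of_forall_le _ _ fun s hs => ?_
    refine (Polynomial.natDegree_C_mul_le _ _).trans ?_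
    rw [← hdeg s hs]
    exact (natDegree_prod_linear_pow_le_and_coeff z w s s.support).1
  · rw [Polynomial.finsetSum_coeff]
    refine Finset.sum_congr rfl fun s hs => ?_
    rw [Polynomial.coeff_C_mul, ← hdeg s hs,
      (natDegree_prod_linear_pow_le_and_coeff z w s s.support).2]

theorem IsHomogeneous.exists_aeval_line_eq_prod (hp : p.IsHomogeneous m) (z : σ → ℂ)
    {w : σ → ℂ} (hw : MvPolynomial.aeval w p ≠ 0) :
    ∃ R : Multiset ℂ, R.card = m ∧
      ∀ μ : ℂ, MvPolynomial.aeval (z + μ • w) p = MvPolynomial.aeval w p * (R.map (μ - ·)).prod := by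
  obtain ⟨hle, hcoeff⟩ := hp.natDegree_linePolynomial_le_and_coeff z w
  have hdeg : (linePolynomial p z w).natDegree = m :=
    Polynomial.natDegree_eq_of_le_of_coeff_ne_zero hle (hcoeff ▸ hw)
  have hsplit := IsAlgClosed.splits (linePolynomial p z w)
  refine ⟨(linePolynomial p z w).roots, hsplit.natDegree_eq_card_roots ▸ hdeg, fun μ => ?_⟩
  rw [← eval_linePolynomial, hsplit.eval_eq_prod_roots, Polynomial.leadingCoeff, hdeg, hcoeff]

theorem _root_.Multiset.pow_im_le_norm_prod_sub {μ : ℂ} (hμ : 0 ≤ μ.im) (R : Multiset ℂ)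
    (hR : ∀ r ∈ R, r.im ≤ 0) : μ.im ^ R.card ≤ ‖(R.map (μ - ·)).prod‖ := by
  induction R using Multiset.induction_on with
  | empty => simp
  | cons a R ih =>
    have ha : a.im ≤ 0 := hR a (Multiset.mem_cons_self a R)
    have hfactor : μ.im ≤ ‖μ - a‖ := by
      have := (le_abs_self _).trans (Complex.abs_im_le_norm (μ - a))
      rw [Complex.sub_im] at this
      linarith
    have := ih fun r hr => hR r (Multiset.mem_cons_of_mem hr)
    rw [Multiset.card_cons, Multiset.map_cons, Multiset.prod_cons, norm_mul, pow_succ']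
    gcongr

/-- A homogeneous polynomial without zeros on the open upper half of a complex line is bounded
below there. -/
theorem IsHomogeneous.norm_aeval_mul_pow_im_le (hp : p.IsHomogeneous m) {z w : σ → ℂ}
    (h : ∀ μ : ℂ, 0 < μ.im → MvPolynomial.aeval (z + μ • w) p ≠ 0) {μ : ℂ} (hμ : 0 ≤ μ.im) :
    ‖MvPolynomial.aeval w p‖ * μ.im ^ m ≤ ‖MvPolynomial.aeval (z + μ • w) p‖ := by
  by_cases hw : MvPolynomial.aeval w p = 0
  · simp [hw]
  obtain ⟨R, hcard, hR⟩ := hp.exists_aeval_line_eq_prod z hw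
  rw [hR, norm_mul, ← hcard]
  gcongr
  refine Multiset.pow_im_le_norm_prod_sub hμ R fun r hr => ?_
  by_contra! hr0
  refine h r hr0 ?_
  rw [hR, Multiset.prod_eq_zero, mul_zero]
  exact Multiset.mem_map.mpr ⟨r, hr, sub_self r⟩

end Factorization

section Hyperbolic

variable {σ : Type*} {m : ℕ} {p : MvPolynomial σ ℝ} {ξ : σ → ℝ}

/-- `p` is hyperbolic in direction `x`. -/
def IsHyperbolic (p : MvPolynomial σ ℝ) (x : σ → ℝ) : Prop :=
  ∀ y : σ → ℝ, aeval (fun j => (x j : ℂ) + Complex.I * (y j : ℂ)) p ≠ 0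

/-- The set of `x` such that `t ↦ p (x + t ξ)` has no nonnegative real root. -/
def hyperbolicityCone (p : MvPolynomial σ ℝ) (ξ : σ → ℝ) : Set (σ → ℝ) :=
  {x | ∀ t : ℝ, 0 ≤ t → eval (x + t • ξ) p ≠ 0}

/-- The inclusion of real vectors into complex vectors. -/
def complexify (x : σ → ℝ) : σ → ℂ := fun j => (x j : ℂ)

theorem aeval_complexify (x : σ → ℝ) : aeval (complexify x) p = (eval x p : ℂ) := by
  have := aeval_algebraMap_apply (R := ℝ) (A := ℝ) ℂ x p
  rwa [aeval_eq_eval] at this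

theorem aeval_complexify_ne_zero {x : σ → ℝ} : aeval (complexify x) p ≠ 0 ↔ eval x p ≠ 0 := by
  rw [aeval_complexify, Complex.ofReal_ne_zero]

theorem continuous_aeval_complex : Continuous fun z : σ → ℂ => aeval z p := by
  simp only [aeval_def, eval₂_eq]
  fun_prop

theorem continuous_complexify : Continuous (complexify : (σ → ℝ) → σ → ℂ) := by
  unfold complexify
  fun_prop

theorem IsHomogeneous.eval_smul_ne_zero (hp : p.IsHomogeneous m) {c : ℝ} (hc : c ≠ 0)
    {x : σ → ℝ} : eval (c • x) p ≠ 0 ↔ eval x p ≠ 0 := by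
  have h : complexify (c • x) = (c : ℂ) • complexify x := by
    ext j
    simp [complexify]
  rw [← aeval_complexify_ne_zero, ← aeval_complexify_ne_zero, h, hp.aeval_smul_complex]
  simp [hc]

theorem IsHyperbolic.eval_ne_zero (h : IsHyperbolic p ξ) : eval ξ p ≠ 0 := by
  rw [← aeval_complexify_ne_zero]
  have h0 := h 0
  simp only [Pi.zero_apply, Complex.ofReal_zero, mul_zero, add_zero] at h0
  exact h0

theorem IsHyperbolic.aeval_line_ne_zero (h : IsHyperbolic p ξ) (hp : p.IsHomogeneous m)
    (x : σ → ℝ) {t : ℂ} (ht : t.im ≠ 0) : aeval (complexify x + t • complexify ξ) p ≠ 0 := by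
  have hvec : complexify x + t • complexify ξ = (t.im * Complex.I) •
      fun j => (ξ j : ℂ) + Complex.I * ((-(x j + t.re * ξ j) / t.im : ℝ) : ℂ) := by
    ext j
    have ht' : (t.im : ℂ) ≠ 0 := by exact_mod_cast ht
    simp only [complexify, Pi.add_apply, Pi.smul_apply, smul_eq_mul]
    push_cast
    field_simp
    linear_combination (-(ξ j : ℂ)) * Complex.re_add_im t +
      ((x j : ℂ) + ξ j * t.re) * Complex.I_mul_I
  rw [hvec, hp.aeval_smul_complex]
  exact mul_ne_zero (pow_ne_zero _ (mul_ne_zero (by exact_mod_cast ht) Complex.I_ne_zero)) (h _)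

theorem mem_hyperbolicityCone_iff_segment (hp : p.IsHomogeneous m) (hξ : eval ξ p ≠ 0)
    {x : σ → ℝ} :
    x ∈ hyperbolicityCone p ξ ↔
      ∀ s ∈ Set.Icc (0 : ℝ) 1, eval ((1 - s) • x + s • ξ) p ≠ 0 := by
  constructor
  · rintro hx s ⟨hs0, hs1⟩
    rcases hs1.eq_or_lt with rfl | hs1
    · simpa using hξ
    have hs : 1 - s ≠ 0 := by linarith
    have hvec : (1 - s) • x + s • ξ = (1 - s) • (x + (s / (1 - s)) • ξ) := by
      rw [smul_add, smul_smul, mul_div_cancel₀ _ hs]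
    rw [hvec, hp.eval_smul_ne_zero hs]
    exact hx _ (div_nonneg hs0 (by linarith))
  · intro h t ht
    have ht1 : (1 + t) ≠ 0 := by linarith
    have hvec : x + t • ξ = (1 + t) • ((1 - t / (1 + t)) • x + (t / (1 + t)) • ξ) := by
      rw [smul_add, smul_smul, smul_smul, mul_div_cancel₀ _ ht1, mul_sub,
        mul_div_cancel₀ _ ht1]
      simp
    rw [hvec, hp.eval_smul_ne_zero ht1]
    refine h _ ⟨by positivity, ?_⟩
    rw [div_le_one (by linarith)]
    linarith

theorem isOpen_hyperbolicityCone (hp : p.IsHomogeneous m) (hξ : eval ξ p ≠ 0) :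
    IsOpen (hyperbolicityCone p ξ) := by
  rw [isOpen_iff_eventually]
  intro x hx
  simp only [mem_hyperbolicityCone_iff_segment hp hξ] at hx ⊢
  refine isCompact_Icc.eventually_forall_of_forall_eventually fun s hs => ?_
  have hcont : Continuous fun q : (σ → ℝ) × ℝ => eval ((1 - q.2) • q.1 + q.2 • ξ) p :=
    p.continuous_eval.comp (by fun_prop)
  exact hcont.continuousAt.eventually_ne (hx s hs)

theorem self_mem_hyperbolicityCone (hp : p.IsHomogeneous m) (hξ : eval ξ p ≠ 0) :
    ξ ∈ hyperbolicityCone p ξ := by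
  rw [mem_hyperbolicityCone_iff_segment hp hξ]
  intro s _
  rwa [← add_smul, sub_add_cancel, one_smul]

theorem eval_ne_zero_of_mem_hyperbolicityCone {x : σ → ℝ} (hx : x ∈ hyperbolicityCone p ξ) :
    eval x p ≠ 0 := by
  simpa using hx 0 le_rfl

theorem complexify_add_smul (x : σ → ℝ) (t : ℝ) :
    complexify (x + t • ξ) = complexify x + (t : ℂ) • complexify ξ := by
  ext j
  simp [complexify]

/-- On the cone, all roots of `t ↦ p (x + t ξ)` are negative real numbers. -/
theorem IsHyperbolic.aeval_line_ne_zero_of_mem_cone (h : IsHyperbolic p ξ)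
    (hp : p.IsHomogeneous m) {x : σ → ℝ} (hx : x ∈ hyperbolicityCone p ξ) {t : ℂ}
    (ht : t.im = 0 → 0 ≤ t.re) : aeval (complexify x + t • complexify ξ) p ≠ 0 := by
  by_cases him : t.im = 0
  · have hre : t = (t.re : ℂ) := Complex.ext rfl (by simpa using him)
    rw [hre, ← complexify_add_smul, aeval_complexify_ne_zero]
    exact hx _ (ht him)
  · exact h.aeval_line_ne_zero hp x him

theorem IsHyperbolic.abs_eval_mul_pow_le (h : IsHyperbolic p ξ) (hp : p.IsHomogeneous m)
    {x : σ → ℝ} (hx : x ∈ hyperbolicityCone p ξ) {t : ℝ} (ht : 0 ≤ t) :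
    |eval ξ p| * t ^ m ≤ |eval (x + t • ξ) p| := by
  have hvec (μ : ℂ) : Complex.I • complexify x + μ • complexify ξ =
      Complex.I • (complexify x + (-Complex.I * μ) • complexify ξ) := by
    rw [smul_add, smul_smul, ← mul_assoc, mul_neg, Complex.I_mul_I, neg_neg, one_mul]
  have key := hp.norm_aeval_mul_pow_im_le (z := Complex.I • complexify x)
    (w := complexify ξ) (μ := t * Complex.I) (fun μ hμ => by
      rw [hvec, hp.aeval_smul_complex]
      refine mul_ne_zero (pow_ne_zero _ Complex.I_ne_zero)
        (h.aeval_line_ne_zero_of_mem_cone hp hx fun _ => ?_)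
      simpa using hμ.le) (by simpa using ht)
  have hmul : -Complex.I * (t * Complex.I) = t := by
    linear_combination (-(t : ℂ)) * Complex.I_mul_I
  rw [hvec, hp.aeval_smul_complex, hmul, ← complexify_add_smul, aeval_complexify,
    aeval_complexify, norm_mul, norm_pow, Complex.norm_I, one_pow, one_mul, Complex.norm_real,
    Complex.norm_real] at key
  simpa using key

theorem IsHyperbolic.connectedComponentIn_eq_hyperbolicityCone (h : IsHyperbolic p ξ)
    (hp : p.IsHomogeneous m) :
    connectedComponentIn {x : σ → ℝ | eval x p ≠ 0} ξ = hyperbolicityCone p ξ := by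
  have hξ := h.eval_ne_zero
  apply Set.Subset.antisymm
  · refine isPreconnected_connectedComponentIn.subset_of_closure_inter_subset
      (isOpen_hyperbolicityCone hp hξ)
      ⟨ξ, mem_connectedComponentIn hξ, self_mem_hyperbolicityCone hp hξ⟩ ?_
    rintro x ⟨hx, hxK⟩ t ht
    rcases ht.eq_or_lt with rfl | ht
    · simpa using connectedComponentIn_subset _ _ hxK
    have hclosed : IsClosed {x : σ → ℝ | |eval ξ p| * t ^ m ≤ |eval (x + t • ξ) p|} :=
      isClosed_le continuous_const (p.continuous_eval.comp (by fun_prop)).abs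
    have hle : |eval ξ p| * t ^ m ≤ |eval (x + t • ξ) p| :=
      closure_minimal (fun y hy => h.abs_eval_mul_pow_le hp hy ht.le) hclosed hx
    exact abs_pos.mp (lt_of_lt_of_le (by positivity) hle)
  · intro x hx
    have hseg := (mem_hyperbolicityCone_iff_segment hp hξ).mp hx
    have himage : IsPreconnected ((fun s : ℝ => (1 - s) • x + s • ξ) '' Set.Icc 0 1) :=
      isPreconnected_Icc.image _ (by fun_prop)
    refine himage.subset_connectedComponentIn ⟨1, by simp, by simp⟩ ?_ ⟨0, by simp, by simp⟩
    rintro _ ⟨s, hs, rfl⟩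
    exact hseg s hs

theorem isCompact_upperHalfPlane_projective :
    IsCompact {q : ℝ × ℂ | 0 ≤ q.1 ∧ 0 ≤ q.2.im ∧ q.1 + ‖q.2‖ = 1} := by
  refine IsCompact.of_isClosed_subset
    (isCompact_Icc.prod (isCompact_closedBall (0 : ℂ) 1) : IsCompact (Set.Icc (0 : ℝ) 1 ×ˢ _))
    ?_ ?_
  · exact (isClosed_le continuous_const continuous_fst).inter
      ((isClosed_le continuous_const (Complex.continuous_im.comp continuous_snd)).inter
        (isClosed_eq (by fun_prop) continuous_const))
  · rintro ⟨u, v⟩ ⟨hu, -, huv⟩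
    simp only at hu huv
    have := norm_nonneg v
    exact ⟨⟨hu, by linarith⟩, by simpa using by linarith⟩

/-- Moving `y` along the segment from `0`, no root of `μ ↦ p (y + i δ ξ + μ x)` can reach the
closed upper half-plane. -/
theorem IsHyperbolic.aeval_shift_ne_zero (h : IsHyperbolic p ξ) (hp : p.IsHomogeneous m)
    {x : σ → ℝ} (hx : x ∈ hyperbolicityCone p ξ) (y : σ → ℝ) {δ : ℝ} (hδ : 0 < δ) {μ : ℂ}
    (hμ : 0 ≤ μ.im) :
    aeval ((complexify y + (δ * Complex.I) • complexify ξ) + μ • complexify x) p ≠ 0 := by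
  have hx0 := aeval_complexify_ne_zero.mpr (eval_ne_zero_of_mem_hyperbolicityCone hx)
  set Z : ℝ → σ → ℂ := fun s => (s : ℂ) • complexify y + (δ * Complex.I) • complexify ξ with hZ
  have hZcont : Continuous Z := by fun_prop
  set T : Set ℝ := {s | ∀ μ : ℂ, 0 ≤ μ.im → aeval (Z s + μ • complexify x) p ≠ 0}
  have hreal (s : ℝ) {μ : ℂ} (hμ : μ.im = 0) : aeval (Z s + μ • complexify x) p ≠ 0 := by
    have hvec : Z s + μ • complexify x =
        complexify (s • y + μ.re • x) + (δ * Complex.I) • complexify ξ := by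
      have hre : μ = (μ.re : ℂ) := Complex.ext rfl (by simpa using hμ)
      rw [hre]
      ext j
      simp [complexify, hZ]
      ring
    rw [hvec]
    exact h.aeval_line_ne_zero hp _ (by simpa using hδ.ne')
  have hopen : IsOpen T := by
    have hproj : T = {s | ∀ q ∈ {q : ℝ × ℂ | 0 ≤ q.1 ∧ 0 ≤ q.2.im ∧ q.1 + ‖q.2‖ = 1},
        aeval ((q.1 : ℂ) • Z s + q.2 • complexify x) p ≠ 0} := by
      ext s
      constructor
      · rintro hs ⟨u, v⟩ ⟨hu, hv, huv⟩
        simp only at hu hv huv ⊢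
        rcases hu.eq_or_lt with rfl | hu
        · rw [Complex.ofReal_zero, zero_smul, zero_add, hp.aeval_smul_complex]
          refine mul_ne_zero (pow_ne_zero _ ?_) hx0
          rintro rfl
          simp at huv
        · have hu' : (u : ℂ) ≠ 0 := by exact_mod_cast hu.ne'
          have hvec : (u : ℂ) • Z s + v • complexify x =
              (u : ℂ) • (Z s + (v / u) • complexify x) := by
            rw [smul_add _ (Z s), smul_smul (u : ℂ) (v / u), mul_div_cancel₀ _ hu']
          rw [hvec, hp.aeval_smul_complex]
          refine mul_ne_zero (pow_ne_zero _ hu') (hs _ ?_)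
          rw [Complex.div_ofReal_im]
          positivity
      · intro hs μ hμ
        have hpos : 0 < 1 + ‖μ‖ := by positivity
        have hc : ((1 + ‖μ‖ : ℝ) : ℂ)⁻¹ ≠ 0 := inv_ne_zero (by exact_mod_cast hpos.ne')
        have := hs ((1 + ‖μ‖)⁻¹, ((1 + ‖μ‖ : ℝ) : ℂ)⁻¹ * μ) ⟨by positivity, by
          rw [← Complex.ofReal_inv, Complex.im_ofReal_mul]
          positivity, by
          rw [norm_mul, norm_inv, Complex.norm_real, Real.norm_of_nonneg hpos.le]
          field_simp⟩
        rw [Complex.ofReal_inv, ← smul_smul, ← smul_add, hp.aeval_smul_complex] at this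
        exact right_ne_zero_of_mul this
    rw [hproj, isOpen_iff_eventually]
    intro s hs
    refine isCompact_upperHalfPlane_projective.eventually_forall_of_forall_eventually
      fun q hq => ?_
    have hcont : Continuous fun r : ℝ × ℝ × ℂ =>
        aeval ((r.2.1 : ℂ) • Z r.1 + r.2.2 • complexify x) p :=
      continuous_aeval_complex.comp (by fun_prop)
    exact hcont.continuousAt.eventually_ne (hs q hq)
  have hzero : (0 : ℝ) ∈ T := by
    intro μ hμ
    by_cases hμ0 : μ = 0
    · exact hreal 0 (by simp [hμ0])
    have hvec : Z 0 + μ • complexify x =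
        μ • (complexify x + (δ * Complex.I / μ) • complexify ξ) := by
      rw [smul_add, smul_smul, mul_div_cancel₀ _ hμ0]
      simp [hZ, add_comm]
    rw [hvec, hp.aeval_smul_complex]
    refine mul_ne_zero (pow_ne_zero _ hμ0) (h.aeval_line_ne_zero_of_mem_cone hp hx fun _ => ?_)
    have hre : (δ * Complex.I / μ).re = δ * μ.im / Complex.normSq μ := by
      simp [Complex.div_re]
    rw [hre]
    have := Complex.normSq_nonneg μ
    positivity
  have hclosed : closure T ⊆ T := by
    intro s hs μ hμ
    rcases hμ.eq_or_lt with hμ0 | hμ0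
    · exact hreal s hμ0.symm
    have hset : IsClosed {s : ℝ | ‖aeval (complexify x) p‖ * μ.im ^ m ≤
        ‖aeval (Z s + μ • complexify x) p‖} :=
      isClosed_le continuous_const (continuous_aeval_complex.comp (by fun_prop)).norm
    have hle : ‖aeval (complexify x) p‖ * μ.im ^ m ≤ ‖aeval (Z s + μ • complexify x) p‖ :=
      closure_minimal
        (fun r (hr : r ∈ T) => hp.norm_aeval_mul_pow_im_le (fun ν hν => hr ν hν.le) hμ) hset hs
    exact norm_pos_iff.mp (lt_of_lt_of_le
      (mul_pos (norm_pos_iff.mpr hx0) (pow_pos hμ0 m)) hle)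
  have hmem := isPreconnected_univ.subset_of_closure_inter_subset hopen ⟨0, trivial, hzero⟩
    (Set.inter_subset_left.trans hclosed) (Set.mem_univ (1 : ℝ)) μ hμ
  simpa [hZ] using hmem

theorem IsHyperbolic.of_mem_hyperbolicityCone (h : IsHyperbolic p ξ) (hp : p.IsHomogeneous m)
    {x : σ → ℝ} (hx : x ∈ hyperbolicityCone p ξ) : IsHyperbolic p x := by
  intro y
  have hcont : Continuous fun δ : ℝ => x - δ • ξ := by fun_prop
  have hev : ∀ᶠ δ : ℝ in 𝓝 0, x - δ • ξ ∈ hyperbolicityCone p ξ :=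
    hcont.continuousAt.eventually_mem
      ((isOpen_hyperbolicityCone hp h.eval_ne_zero).mem_nhds (by simpa using hx))
  obtain ⟨δ, hδx, hδ⟩ :=
    ((hev.filter_mono nhdsWithin_le_nhds).and self_mem_nhdsWithin :
      ∀ᶠ δ : ℝ in 𝓝[>] 0, _ ∧ δ ∈ Set.Ioi (0 : ℝ)).exists
  have hne := h.aeval_shift_ne_zero hp hδx (-y) hδ (μ := Complex.I) (by simp)
  have hvec : complexify (-y) + (δ * Complex.I) • complexify ξ +
      Complex.I • complexify (x - δ • ξ) =
      Complex.I • fun j => (x j : ℂ) + Complex.I * (y j : ℂ) := by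
    ext j
    simp only [complexify, Pi.add_apply, Pi.smul_apply, Pi.neg_apply, Pi.sub_apply, smul_eq_mul]
    push_cast
    linear_combination (-(y j : ℂ)) * Complex.I_mul_I
  rw [hvec, hp.aeval_smul_complex] at hne
  exact right_ne_zero_of_mul hne

theorem IsHyperbolic.add_mem_hyperbolicityCone (h : IsHyperbolic p ξ) (hp : p.IsHomogeneous m)
    {x y : σ → ℝ} (hx : x ∈ hyperbolicityCone p ξ) (hy : y ∈ hyperbolicityCone p ξ) :
    x + y ∈ hyperbolicityCone p ξ := by
  have hcone : hyperbolicityCone p ξ = hyperbolicityCone p y := by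
    rw [← h.connectedComponentIn_eq_hyperbolicityCone hp] at hy ⊢
    rw [connectedComponentIn_eq hy]
    rw [h.connectedComponentIn_eq_hyperbolicityCone hp] at hy
    exact (h.of_mem_hyperbolicityCone hp hy).connectedComponentIn_eq_hyperbolicityCone hp
  rw [hcone] at hx ⊢
  intro t ht
  have := hx (1 + t) (by linarith)
  rwa [add_smul, one_smul, ← add_assoc] at this

theorem smul_mem_hyperbolicityCone (hp : p.IsHomogeneous m) {x : σ → ℝ}
    (hx : x ∈ hyperbolicityCone p ξ) {c : ℝ} (hc : 0 < c) : c • x ∈ hyperbolicityCone p ξ := by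
  intro t ht
  have hvec : c • x + t • ξ = c • (x + (t / c) • ξ) := by
    rw [smul_add, smul_smul, mul_div_cancel₀ _ hc.ne']
  rw [hvec, hp.eval_smul_ne_zero hc.ne']
  exact hx _ (by positivity)

theorem IsHyperbolic.mem_hyperbolicityCone_iff (h : IsHyperbolic p ξ) (hp : p.IsHomogeneous m)
    {x : σ → ℝ} :
    x ∈ hyperbolicityCone p ξ ↔ ∀ t : ℂ,
      aeval (fun j => (x j : ℂ) + t * (ξ j : ℂ)) p = 0 → ∃ r : ℝ, r < 0 ∧ t = (r : ℂ) := by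
  constructor
  · intro hx t ht
    have hroot := mt (h.aeval_line_ne_zero_of_mem_cone hp hx (t := t)) (not_not.mpr ht)
    push Not at hroot
    exact ⟨t.re, hroot.2, Complex.ext rfl (by simpa using hroot.1)⟩
  · intro hx t ht h0
    obtain ⟨r, hr, hrt⟩ := hx t (by
      have := aeval_complexify (p := p) (x + t • ξ)
      rw [complexify_add_smul, h0, Complex.ofReal_zero] at this
      exact this)
    rw [Complex.ofReal_inj] at hrt
    linarith

end Hyperbolic

end MvPolynomial

/-- **Proposition (cones of hyperbolicity).**
Let `p` be a real homogeneous polynomial hyperbolic in direction `ξ`, and let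
`K = K(p, ξ)` be the connected component of `{x ∈ ℝ^d : p(x) ≠ 0}` containing `ξ`.
Then (i) `p` is hyperbolic in every direction `x ∈ K`; (ii) `K` is an open convex cone
(closed under addition and under multiplication by positive scalars); (iii) `K` is the
set of `x` such that every root of `t ↦ p(x + t ξ)` is real and strictly negative. -/
theorem stmt3 (d m : ℕ) (p : MvPolynomial (Fin d) ℝ) (hp : p.IsHomogeneous m)
    (ξ : Fin d → ℝ)
    (hyp : ∀ y : Fin d → ℝ,
      MvPolynomial.aeval (fun j => (ξ j : ℂ) + Complex.I * (y j : ℂ)) p ≠ 0)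
    (K : Set (Fin d → ℝ))
    (hK : K = connectedComponentIn {x : Fin d → ℝ | MvPolynomial.eval x p ≠ 0} ξ) :
    (∀ x ∈ K, ∀ y : Fin d → ℝ,
        MvPolynomial.aeval (fun j => (x j : ℂ) + Complex.I * (y j : ℂ)) p ≠ 0) ∧
    (IsOpen K ∧ (∀ x ∈ K, ∀ y ∈ K, x + y ∈ K) ∧ (∀ x ∈ K, ∀ c : ℝ, 0 < c → c • x ∈ K)) ∧
    (K = {x : Fin d → ℝ | ∀ t : ℂ,
        MvPolynomial.aeval (fun j => (x j : ℂ) + t * (ξ j : ℂ)) p = 0 →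
          ∃ r : ℝ, r < 0 ∧ t = (r : ℂ)}) := by
  have h : MvPolynomial.IsHyperbolic p ξ := hyp
  rw [hK, h.connectedComponentIn_eq_hyperbolicityCone hp]
  exact ⟨fun x hx => h.of_mem_hyperbolicityCone hp hx,
    ⟨MvPolynomial.isOpen_hyperbolicityCone hp h.eval_ne_zero,
      fun x hx y hy => h.add_mem_hyperbolicityCone hp hx hy,
      fun x hx c hc => MvPolynomial.smul_mem_hyperbolicityCone hp hx hc⟩,
    Set.ext fun x => h.mem_hyperbolicityCone_iff hp⟩
end

section
/- Let f be a nonzero real polynomial in variables z_1,…,z_d of total degree m, and let f_H be its homogenization: the unique homogeneous polynomial of degree m in z_1,…,z_{d+1} with f_H(z_1,…,z_d,1) = f(z_1,…,z_d). Then f is stable if and only if f_H is hyperbolic in every direction (v_1,…,v_d,0) with v_j > 0 for 1 ≤ j ≤ d. If moreover f has nonnegative coefficients, then the following are equivalent: (i) f is stable; (ii) f_H is stable; (iii) f_H is hyperbolic with respect to some nonzero vector in the closed nonnegative orthant of ℝ^{d+1}; (iv) f_H is hyperbolic with respect to every vector in the open positive orthant of ℝ^{d+1}. -/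
theorem MvPolynomial.aeval_smul_of_isHomogeneous {σ R A : Type*} [CommSemiring R] [CommSemiring A]
    [Algebra R A] {p : MvPolynomial σ R} {m : ℕ} (hp : p.IsHomogeneous m) (c : A) (z : σ → A) :
    aeval (c • z) p = c ^ m * aeval z p := by
  simp only [aeval_def, eval₂_eq, Finset.mul_sum]
  refine Finset.sum_congr rfl fun d hd => ?_
  have h : ∏ i ∈ d.support, c ^ d i = c ^ m := by
    rw [Finset.prod_pow_eq_pow_sum, hp.degree_eq_sum_deg_support hd]
  simp only [Pi.smul_apply, smul_eq_mul, mul_pow, Finset.prod_mul_distrib, h]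
  ring

theorem Polynomial.natDegree_prod_le_and_coeff_prod {R ι : Type*} [CommSemiring R] (s : Finset ι)
    (f : ι → Polynomial R) (n : ι → ℕ) (h : ∀ i ∈ s, (f i).natDegree ≤ n i) :
    (∏ i ∈ s, f i).natDegree ≤ ∑ i ∈ s, n i ∧
      (∏ i ∈ s, f i).coeff (∑ i ∈ s, n i) = ∏ i ∈ s, (f i).coeff (n i) := by
  classical
  induction s using Finset.induction_on with
  | empty => simp
  | insert a s ha ih =>
    obtain ⟨h1, h2⟩ := ih fun i hi => h i (Finset.mem_insert_of_mem hi)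
    have h3 := h a (Finset.mem_insert_self a s)
    rw [Finset.prod_insert ha, Finset.sum_insert ha, Finset.prod_insert ha]
    exact ⟨Polynomial.natDegree_mul_le_of_le h3 h1,
      by rw [Polynomial.coeff_mul_add_eq_of_natDegree_le h3 h1, h2]⟩

/-- The restriction of a homogeneous polynomial of degree `m` to the line `z + s • w` has degree
at most `m`, and its coefficient of degree `m` is the value at `w`. -/
theorem MvPolynomial.exists_polynomial_eval_add_smul {σ R A : Type*}
    [CommSemiring R] [CommSemiring A] [Algebra R A] {p : MvPolynomial σ R} {m : ℕ}
    (hp : p.IsHomogeneous m) (z w : σ → A) :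
    ∃ q : Polynomial A, q.natDegree ≤ m ∧ q.coeff m = aeval w p ∧
      ∀ s, q.eval s = aeval (z + s • w) p := by
  have key : ∀ d ∈ p.support,
      (∏ i ∈ d.support, (Polynomial.C (z i) + Polynomial.C (w i) * Polynomial.X) ^ d i).natDegree
        ≤ m ∧
      (∏ i ∈ d.support, (Polynomial.C (z i) + Polynomial.C (w i) * Polynomial.X) ^ d i).coeff m
        = ∏ i ∈ d.support, w i ^ d i := by
    intro d hd
    have hlin : ∀ i, (Polynomial.C (z i) + Polynomial.C (w i) * Polynomial.X).natDegree ≤ 1 :=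
      fun i => by compute_degree
    have h := Polynomial.natDegree_prod_le_and_coeff_prod d.support
      (fun i => (Polynomial.C (z i) + Polynomial.C (w i) * Polynomial.X) ^ d i) d
      (fun i _ => (Polynomial.natDegree_pow_le_of_le (d i) (hlin i)).trans (by simp))
    rw [show ∑ i ∈ d.support, d i = m from (hp.degree_eq_sum_deg_support hd).symm] at h
    refine ⟨h.1, h.2.trans (Finset.prod_congr rfl fun i _ => ?_)⟩
    have := Polynomial.coeff_pow_of_natDegree_le (m := d i) (hlin i)
    simpa using this
  refine ⟨∑ d ∈ p.support, Polynomial.C (algebraMap R A (p.coeff d)) *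
    ∏ i ∈ d.support, (Polynomial.C (z i) + Polynomial.C (w i) * Polynomial.X) ^ d i, ?_, ?_, ?_⟩
  · exact Polynomial.natDegree_sum_le_of_forall_le _ _ fun d hd =>
      (Polynomial.natDegree_C_mul_le _ _).trans (key d hd).1
  · rw [Polynomial.finsetSum_coeff, aeval_def, eval₂_eq]
    refine Finset.sum_congr rfl fun d hd => ?_
    rw [Polynomial.coeff_C_mul, (key d hd).2]
  · intro s
    simp only [aeval_def, eval₂_eq, Polynomial.eval_finsetSum, Polynomial.eval_mul,
      Polynomial.eval_C, Polynomial.eval_prod, Polynomial.eval_pow, Polynomial.eval_add,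
      Polynomial.eval_X, Pi.add_apply, Pi.smul_apply, smul_eq_mul, mul_comm s]

theorem Multiset.pow_card_le_norm_prod (s : Multiset ℂ) {δ : ℝ} (hδ : 0 ≤ δ)
    (h : ∀ r ∈ s, δ ≤ ‖r‖) : δ ^ s.card ≤ ‖s.prod‖ := by
  induction s using Multiset.induction_on with
  | empty => simp
  | cons a s ih =>
    rw [Multiset.card_cons, Multiset.prod_cons, norm_mul, pow_succ']
    exact mul_le_mul (h a (Multiset.mem_cons_self a s))
      (ih fun r hr => h r (Multiset.mem_cons_of_mem hr)) (by positivity) (norm_nonneg _)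

/-- If a homogeneous polynomial has no zero on the disc `z + s • w`, `‖s‖ < δ`, then its value
at `z` is bounded below in terms of its value at `w`. -/
theorem MvPolynomial.pow_mul_norm_aeval_le {σ R : Type*} [CommSemiring R]
    [Algebra R ℂ] {p : MvPolynomial σ R} {m : ℕ} (hp : p.IsHomogeneous m) (z w : σ → ℂ)
    {δ : ℝ} (hδ : 0 < δ) (h : ∀ s : ℂ, ‖s‖ < δ → aeval (z + s • w) p ≠ 0) :
    δ ^ m * ‖aeval w p‖ ≤ ‖aeval z p‖ := by
  obtain ⟨q, hqd, hqc, hq⟩ := exists_polynomial_eval_add_smul hp z w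
  rcases eq_or_ne (aeval w p) 0 with hw | hw
  · simp [hw]
  have hdeg : q.natDegree = m :=
    le_antisymm hqd (Polynomial.le_natDegree_of_ne_zero (by rwa [hqc]))
  have hroots : ∀ r ∈ q.roots, δ ≤ ‖r‖ := by
    intro r hr
    by_contra! hlt
    exact h r hlt (by rw [← hq, (Polynomial.mem_roots'.1 hr).2])
  have hsp := IsAlgClosed.splits q
  have h0 : q.coeff 0 = aeval z p := by
    rw [Polynomial.coeff_zero_eq_eval_zero, hq]; simp
  have hb := q.roots.pow_card_le_norm_prod hδ.le hroots
  rw [← hsp.natDegree_eq_card_roots, hdeg] at hb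
  rw [← h0, hsp.coeff_zero_eq_leadingCoeff_mul_prod_roots, norm_mul, norm_mul, norm_pow,
    Polynomial.leadingCoeff, hdeg, hqc]
  simp only [norm_neg, norm_one, one_pow, one_mul]
  rw [mul_comm]
  gcongr

theorem MvPolynomial.continuous_aeval_complex_s11 {σ : Type*} (p : MvPolynomial σ ℝ) :
    Continuous fun z : σ → ℂ => aeval z p := by
  simp only [aeval_def, eval₂_eq]
  fun_prop

theorem MvPolynomial.aeval_ofReal {σ : Type*} (p : MvPolynomial σ ℝ) (x : σ → ℝ) :
    aeval (fun j => (x j : ℂ)) p = (eval x p : ℂ) := by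
  simp [aeval_def, eval₂_eq, eval_eq]

theorem MvPolynomial.aeval_conj {σ : Type*} (p : MvPolynomial σ ℝ) (z : σ → ℂ) :
    aeval (fun j => starRingEnd ℂ (z j)) p = starRingEnd ℂ (aeval z p) := by
  simp [aeval_def, eval₂_eq]

section Garding

open MvPolynomial

variable {σ : Type*} {p : MvPolynomial σ ℝ} {m : ℕ}

theorem MvPolynomial.aeval_ne_zero_of_smul (hp : p.IsHomogeneous m) {c : ℂ} {z : σ → ℂ}
    (h : aeval (c • z) p ≠ 0) : aeval z p ≠ 0 := by
  rw [aeval_smul_of_isHomogeneous hp] at h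
  exact right_ne_zero_of_mul h

theorem MvPolynomial.aeval_smul_ne_zero (hp : p.IsHomogeneous m) {c : ℂ} (hc : c ≠ 0)
    {z : σ → ℂ} (h : aeval z p ≠ 0) : aeval (c • z) p ≠ 0 := by
  rw [aeval_smul_of_isHomogeneous hp]
  exact mul_ne_zero (pow_ne_zero _ hc) h

/-- A hyperbolic polynomial has only real zeros on real lines in the direction `w`. -/
theorem MvPolynomial.aeval_add_smul_ne_zero_of_hyperbolic (hp : p.IsHomogeneous m) {w : σ → ℝ}
    (hw : ∀ y : σ → ℝ, aeval (fun j => (w j : ℂ) + Complex.I * (y j : ℂ)) p ≠ 0)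
    (x : σ → ℝ) {r : ℂ} (hr : r.im ≠ 0) :
    aeval (fun j => (x j : ℂ) + r * (w j : ℂ)) p ≠ 0 := by
  have hc : Complex.I * (r.im : ℂ) ≠ 0 := by simpa using hr
  convert aeval_smul_ne_zero hp hc (hw fun j => -(x j + r.re * w j) / r.im) using 3
  ext j
  have him : (r.im : ℂ) ≠ 0 := by simpa using hr
  conv_lhs => rw [← Complex.re_add_im r]
  simp only [Pi.smul_apply, smul_eq_mul]
  push_cast
  field_simp
  linear_combination ((x j : ℂ) + r.re * w j) * Complex.I_sq

theorem MvPolynomial.aeval_garding_line_ne_zero (hp : p.IsHomogeneous m) {w a : σ → ℝ}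
    (hw : ∀ y : σ → ℝ, aeval (fun j => (w j : ℂ) + Complex.I * (y j : ℂ)) p ≠ 0)
    (ha : ∀ ρ : ℝ, 0 ≤ ρ → eval (fun j => a j + ρ * w j) p ≠ 0)
    {α : ℝ} (hα : 0 < α) {t : ℂ} (ht : 0 ≤ t.im) :
    aeval (fun j => Complex.I * α * (w j : ℂ) + t * (a j : ℂ)) p ≠ 0 := by
  rcases eq_or_ne t 0 with rfl | ht0
  · convert aeval_add_smul_ne_zero_of_hyperbolic hp hw 0 (r := Complex.I * α) (by simpa using hα.ne')
      using 3 with j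
    simp
  have hfac : (fun j => Complex.I * α * (w j : ℂ) + t * (a j : ℂ)) =
      t • fun j => (a j : ℂ) + (Complex.I * α / t) * (w j : ℂ) := by
    ext j
    simp only [Pi.smul_apply, smul_eq_mul]
    field_simp
    ring
  rw [hfac]
  refine aeval_smul_ne_zero hp ht0 ?_
  by_cases him : (Complex.I * α / t).im = 0
  · obtain ⟨ρ, hρ⟩ : ∃ ρ : ℝ, (ρ : ℂ) = Complex.I * α / t :=
      ⟨(Complex.I * α / t).re, Complex.ext (by simp) (by simp [him])⟩
    have hmul : (ρ : ℂ) * t = Complex.I * α := by rw [hρ]; field_simp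
    have h1 : ρ * t.im = α := by simpa using congrArg Complex.im hmul
    have hρ0 : 0 ≤ ρ := by
      by_contra! hneg
      nlinarith
    rw [← hρ]
    have h2 := aeval_ofReal p fun j => a j + ρ * w j
    push_cast at h2
    rw [h2]
    exact_mod_cast ha ρ hρ0
  · exact aeval_add_smul_ne_zero_of_hyperbolic hp hw a him

variable [Fintype σ]

theorem MvPolynomial.exists_norm_le_of_aeval_smul_add_eq_zero (hp : p.IsHomogeneous m)
    {A : σ → ℂ} (hA : aeval A p ≠ 0) (M : ℝ) :
    ∃ R : ℝ, ∀ (u : σ → ℂ) (t : ℂ), ‖u‖ ≤ M → aeval (t • A + u) p = 0 → ‖t‖ ≤ R := by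
  have hnear : ∀ᶠ z in nhds A, aeval z p ≠ 0 :=
    (continuous_aeval_complex_s11 p).continuousAt.eventually_ne hA
  obtain ⟨r, hr, hball⟩ := Metric.eventually_nhds_iff.1 hnear
  refine ⟨max 0 (M / r), fun u t hu h0 => ?_⟩
  by_contra! hlt
  have ht : 0 < ‖t‖ := (le_max_left _ _).trans_lt hlt
  have htM : M < ‖t‖ * r := (div_lt_iff₀ hr).1 ((le_max_right _ _).trans_lt hlt)
  have ht0 : t ≠ 0 := norm_pos_iff.1 ht
  refine aeval_smul_ne_zero hp ht0 (hball (y := A + t⁻¹ • u) ?_) ?_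
  · rw [dist_eq_norm, add_sub_cancel_left, norm_smul, norm_inv, inv_mul_lt_iff₀ ht]
    exact hu.trans_lt htM
  · rwa [smul_add, smul_smul, mul_inv_cancel₀ ht0, one_smul]

theorem MvPolynomial.aeval_garding_ne_zero (hp : p.IsHomogeneous m) {w a : σ → ℝ}
    (hw : ∀ y : σ → ℝ, aeval (fun j => (w j : ℂ) + Complex.I * (y j : ℂ)) p ≠ 0)
    (ha : ∀ ρ : ℝ, 0 ≤ ρ → eval (fun j => a j + ρ * w j) p ≠ 0)
    (x : σ → ℝ) {α : ℝ} (hα : 0 < α) {t : ℂ} (ht : 0 ≤ t.im) :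
    aeval (fun j => Complex.I * α * (w j : ℂ) + t * (a j : ℂ) + (x j : ℂ)) p ≠ 0 := by
  set A : σ → ℂ := fun j => (a j : ℂ) with hAdef
  have hA : aeval A p ≠ 0 := by
    rw [hAdef, aeval_ofReal]
    have := ha 0 le_rfl
    simpa using this
  set F : ℝ × ℂ → σ → ℂ := fun q j =>
    Complex.I * α * (w j : ℂ) + q.2 * (a j : ℂ) + q.1 * (x j : ℂ) with hF
  have hFc : Continuous F := by rw [hF]; fun_prop
  have hPF : Continuous fun q => aeval (F q) p := (continuous_aeval_complex_s11 p).comp hFc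
  set K : Set (ℝ × ℂ) := {q | q.1 ∈ Set.Icc (0 : ℝ) 1 ∧ 0 ≤ q.2.im ∧ aeval (F q) p = 0} with hK
  suffices hempty : K = ∅ by
    intro h0
    have : ((1 : ℝ), t) ∈ K := ⟨by simp, ht, by simpa [hF] using h0⟩
    simp [hempty] at this
  by_contra hne
  have hKne : K.Nonempty := Set.nonempty_iff_ne_empty.2 hne
  have hKclosed : IsClosed K := by
    refine (isClosed_Icc.preimage continuous_fst).inter (IsClosed.inter ?_ ?_)
    · exact isClosed_le continuous_const (Complex.continuous_im.comp continuous_snd)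
    · exact isClosed_eq hPF continuous_const
  obtain ⟨R, hR⟩ := exists_norm_le_of_aeval_smul_add_eq_zero hp hA
    (‖fun j => Complex.I * α * (w j : ℂ)‖ + ‖fun j => (x j : ℂ)‖)
  have hKcompact : IsCompact K := by
    refine ((isCompact_Icc (a := (0 : ℝ)) (b := 1)).prod (isCompact_closedBall (0 : ℂ) R)).of_isClosed_subset hKclosed ?_
    rintro ⟨β, s⟩ ⟨hβ, -, h0⟩
    refine ⟨hβ, ?_⟩
    rw [mem_closedBall_zero_iff]
    refine hR ((fun j => Complex.I * α * (w j : ℂ)) + (β : ℂ) • fun j => (x j : ℂ)) s ?_ ?_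
    · refine (norm_add_le _ _).trans (add_le_add le_rfl ?_)
      rw [norm_smul]
      refine mul_le_of_le_one_left (norm_nonneg _) ?_
      simpa [abs_of_nonneg hβ.1] using hβ.2
    · convert h0 using 3
      ext j
      simp [hF, hAdef]
      ring
  obtain ⟨⟨β, s⟩, ⟨hβ, hs, h0⟩, hmin⟩ :=
    hKcompact.exists_isMinOn hKne continuous_fst.continuousOn
  have hs0 : 0 < s.im := by
    refine lt_of_le_of_ne hs fun hs' => ?_
    refine aeval_add_smul_ne_zero_of_hyperbolic hp hw (fun j => s.re * a j + β * x j)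
      (r := Complex.I * α) (by simpa using hα.ne') ?_
    have hsre : (s.re : ℂ) = s := Complex.ext (by simp) (by simp [← hs'])
    convert h0 using 3
    ext j
    simp only [hF]
    push_cast
    rw [hsre]
    ring
  have hβ0 : 0 < β := by
    refine lt_of_le_of_ne hβ.1 fun hβ' => ?_
    refine aeval_garding_line_ne_zero hp hw ha hα hs ?_
    convert h0 using 3 with j
    simp [hF, ← hβ']
  have hbound : ∀ γ ∈ Set.Ico 0 β, s.im ^ m * ‖aeval A p‖ ≤ ‖aeval (F (γ, s)) p‖ := by
    intro γ hγ
    refine pow_mul_norm_aeval_le hp _ _ hs0 fun r hr h => ?_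
    have hmem : (γ, s + r) ∈ K := by
      refine ⟨⟨hγ.1, hγ.2.le.trans hβ.2⟩, ?_, ?_⟩
      · have := (abs_le.1 ((Complex.abs_im_le_norm r).trans hr.le)).1
        simp only [Complex.add_im]
        linarith
      · convert h using 3
        ext j
        simp [hF, hAdef]
        ring
    exact absurd (hmin hmem) (not_le.2 hγ.2)
  have hlim : s.im ^ m * ‖aeval A p‖ ≤ ‖aeval (F (β, s)) p‖ := by
    have hcl : IsClosed {γ : ℝ | s.im ^ m * ‖aeval A p‖ ≤ ‖aeval (F (γ, s)) p‖} :=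
      isClosed_le continuous_const (hPF.comp (by fun_prop)).norm
    refine hcl.closure_subset_iff.2 hbound ?_
    rw [closure_Ico hβ0.ne]
    exact Set.right_mem_Icc.2 hβ0.le
  rw [h0, norm_zero] at hlim
  have : 0 < s.im ^ m * ‖aeval A p‖ := mul_pos (pow_pos hs0 m) (norm_pos_iff.2 hA)
  linarith

/-- **Gårding's theorem**: hyperbolicity in direction `w` propagates to any direction `a` such
that the polynomial does not vanish on the ray from `a` in direction `w`. -/
theorem MvPolynomial.hyperbolic_of_eval_ray_ne_zero (hp : p.IsHomogeneous m) {w a : σ → ℝ}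
    (hw : ∀ y : σ → ℝ, aeval (fun j => (w j : ℂ) + Complex.I * (y j : ℂ)) p ≠ 0)
    (ha : ∀ ρ : ℝ, 0 ≤ ρ → eval (fun j => a j + ρ * w j) p ≠ 0) (y : σ → ℝ) :
    aeval (fun j => (a j : ℂ) + Complex.I * (y j : ℂ)) p ≠ 0 := by
  set F : ℝ → σ → ℂ := fun α j =>
    Complex.I * α * (w j : ℂ) + Complex.I * (a j : ℂ) + ((-y j : ℝ) : ℂ) with hF
  have hA : aeval (fun j => (a j : ℂ)) p ≠ 0 := by
    rw [aeval_ofReal]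
    have := ha 0 le_rfl
    simpa using this
  have hbound : ∀ α ∈ Set.Ioi (0 : ℝ), ‖aeval (fun j => (a j : ℂ)) p‖ ≤ ‖aeval (F α) p‖ := by
    intro α hα
    have := pow_mul_norm_aeval_le hp (F α) (fun j => (a j : ℂ)) one_pos fun s hs => by
      have him : 0 ≤ (Complex.I + s).im := by
        have := (abs_le.1 ((Complex.abs_im_le_norm s).trans hs.le)).1
        simp only [Complex.add_im, Complex.I_im]
        linarith
      convert aeval_garding_ne_zero hp hw ha (fun j => -y j) hα him using 3
      ext j
      simp [hF]
      ring
    simpa using this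
  have hFc : Continuous F := by rw [hF]; fun_prop
  have hlim : ‖aeval (fun j => (a j : ℂ)) p‖ ≤ ‖aeval (F 0) p‖ := by
    have hcl : IsClosed {α : ℝ | ‖aeval (fun j => (a j : ℂ)) p‖ ≤ ‖aeval (F α) p‖} :=
      isClosed_le continuous_const ((continuous_aeval_complex_s11 p).comp hFc).norm
    refine hcl.closure_subset_iff.2 hbound ?_
    rw [closure_Ioi]
    exact Set.self_mem_Ici
  refine aeval_ne_zero_of_smul hp (c := Complex.I)
    (norm_pos_iff.1 ((norm_pos_iff.2 hA).trans_le (hlim.trans_eq ?_)))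
  congr 3
  ext j
  simp only [hF, Pi.smul_apply, smul_eq_mul]
  push_cast
  linear_combination -(y j : ℂ) * Complex.I_sq

end Garding

section Homogenization

open MvPolynomial

variable {d m : ℕ} {f : MvPolynomial (Fin d) ℝ} {fH : MvPolynomial (Fin (d + 1)) ℝ}

theorem Fin.smul_snoc {A : Type*} [Mul A] {d : ℕ} (c : A) (z : Fin d → A) (t : A) :
    c • (Fin.snoc z t : Fin (d + 1) → A) = Fin.snoc (c • z) (c * t) := by
  ext j
  induction j using Fin.lastCases <;> simp

theorem MvPolynomial.aeval_snoc_one {A : Type*} [CommSemiring A] [Algebra ℝ A]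
    (hspec : ∀ z : Fin d → ℝ, eval (Fin.snoc z 1) fH = eval z f) (z : Fin d → A) :
    aeval (Fin.snoc z 1 : Fin (d + 1) → A) fH = aeval z f := by
  have hpoly : aeval (Fin.snoc X 1 : Fin (d + 1) → MvPolynomial (Fin d) ℝ) fH = f := by
    refine MvPolynomial.funext fun x => ?_
    rw [← hspec x, ← coe_aeval_eq_eval, ← coe_aeval_eq_eval]
    simp only [RingHom.coe_coe]
    rw [comp_aeval_apply]
    congr 2
    ext j
    induction j using Fin.lastCases <;> simp
  conv_rhs => rw [← hpoly, comp_aeval_apply]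
  congr 2
  ext j
  induction j using Fin.lastCases <;> simp

theorem MvPolynomial.aeval_snoc_of_ne_zero {A : Type*} [Field A] [Algebra ℝ A]
    (hH : fH.IsHomogeneous m)
    (hspec : ∀ z : Fin d → ℝ, eval (Fin.snoc z 1) fH = eval z f) (z : Fin d → A)
    {t : A} (ht : t ≠ 0) :
    aeval (Fin.snoc z t : Fin (d + 1) → A) fH = t ^ m * aeval (t⁻¹ • z) f := by
  rw [← aeval_snoc_one hspec, ← aeval_smul_of_isHomogeneous hH, Fin.smul_snoc, smul_smul,
    mul_inv_cancel₀ ht, one_smul, mul_one]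

theorem MvPolynomial.exists_eval_snoc_zero_ne_zero (hf : f ≠ 0) (hm : f.totalDegree = m)
    (hH : fH.IsHomogeneous m)
    (hspec : ∀ z : Fin d → ℝ, eval (Fin.snoc z 1) fH = eval z f) :
    ∃ w : Fin d → ℝ, eval (Fin.snoc w 0) fH ≠ 0 := by
  have hlead : homogeneousComponent m f ≠ 0 := by
    obtain ⟨e, he, hdeg⟩ := f.support.exists_mem_eq_sup (support_nonempty.2 hf)
      fun s => s.sum fun _ n => n
    intro h0
    have h1 := coeff_homogeneousComponent m f e
    rw [h0, coeff_zero, if_pos (by rw [← hm]; exact hdeg.symm)] at h1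
    exact mem_support_iff.1 he h1.symm
  obtain ⟨w, hw⟩ : ∃ w, eval w (homogeneousComponent m f) ≠ 0 := by
    by_contra! h
    exact hlead (MvPolynomial.funext fun x => by rw [h x, map_zero])
  refine ⟨w, ?_⟩
  have hfun : (fun ε : ℝ => eval (Fin.snoc w ε : Fin (d + 1) → ℝ) fH) =
      fun ε => ∑ i ∈ Finset.range (m + 1), ε ^ (m - i) * eval w (homogeneousComponent i f) := by
    refine Continuous.ext_on (dense_compl_singleton (0 : ℝ)) ?_ (by fun_prop) ?_
    · exact (continuous_eval fH).comp (continuous_const.finSnoc continuous_id)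
    · intro ε hε
      have hε0 : ε ≠ 0 := hε
      have h1 := aeval_snoc_of_ne_zero hH hspec w hε0
      rw [aeval_eq_eval, aeval_eq_eval] at h1
      beta_reduce
      rw [h1]
      conv_lhs => rw [← sum_homogeneousComponent f, hm, map_sum, Finset.mul_sum]
      refine Finset.sum_congr rfl fun i hi => ?_
      have h2 := aeval_smul_of_isHomogeneous (homogeneousComponent_isHomogeneous i f) ε⁻¹ w
      rw [aeval_eq_eval, aeval_eq_eval] at h2
      rw [h2, ← mul_assoc, inv_pow,
        pow_sub₀ ε hε0 (Nat.lt_succ_iff.1 (Finset.mem_range.1 hi))]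
  have h0 := congrFun hfun 0
  simp only [Finset.sum_range_succ] at h0
  rw [Finset.sum_eq_zero] at h0
  · simpa [h0] using hw
  · intro i hi
    rw [zero_pow (Nat.sub_ne_zero_of_lt (Finset.mem_range.1 hi)), zero_mul]

theorem MvPolynomial.aeval_snoc_ne_zero_of_stable_of_pos (hH : fH.IsHomogeneous m)
    (hspec : ∀ z : Fin d → ℝ, eval (Fin.snoc z 1) fH = eval z f)
    (hst : ∀ z : Fin d → ℂ, (∀ j, 0 < (z j).im) → aeval z f ≠ 0)
    {z : Fin d → ℂ} (hz : ∀ j, 0 < (z j).im) {ε : ℝ} (hε : 0 < ε) :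
    aeval (Fin.snoc z (ε : ℂ) : Fin (d + 1) → ℂ) fH ≠ 0 := by
  have hε0 : (ε : ℂ) ≠ 0 := by exact_mod_cast hε.ne'
  rw [aeval_snoc_of_ne_zero hH hspec z hε0]
  refine mul_ne_zero (pow_ne_zero _ hε0) (hst _ fun j => ?_)
  rw [Pi.smul_apply, smul_eq_mul, ← Complex.ofReal_inv, Complex.im_ofReal_mul]
  exact mul_pos (inv_pos.2 hε) (hz j)

theorem MvPolynomial.aeval_snoc_zero_ne_zero_of_stable (hf : f ≠ 0) (hm : f.totalDegree = m)
    (hH : fH.IsHomogeneous m)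
    (hspec : ∀ z : Fin d → ℝ, eval (Fin.snoc z 1) fH = eval z f)
    (hst : ∀ z : Fin d → ℂ, (∀ j, 0 < (z j).im) → aeval z f ≠ 0)
    {z : Fin d → ℂ} (hz : ∀ j, 0 < (z j).im) :
    aeval (Fin.snoc z 0 : Fin (d + 1) → ℂ) fH ≠ 0 := by
  obtain ⟨w, hw⟩ := exists_eval_snoc_zero_ne_zero hf hm hH hspec
  set W : Fin (d + 1) → ℂ := fun j => ((Fin.snoc w 0 : Fin (d + 1) → ℝ) j : ℂ) with hWdef
  have hW : aeval W fH ≠ 0 := by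
    rw [hWdef, aeval_ofReal]
    exact_mod_cast hw
  have hnear : ∀ᶠ s : ℂ in nhds 0, ∀ j, 0 < (z j + s * w j).im := by
    refine Filter.eventually_all.2 fun j => ?_
    have hc : Continuous fun s : ℂ => (z j + s * w j).im := by fun_prop
    exact hc.continuousAt.eventually_const_lt (by simpa using hz j)
  obtain ⟨δ, hδ, hball⟩ := Metric.eventually_nhds_iff.1 hnear
  have hbound : ∀ ε ∈ Set.Ioi (0 : ℝ), δ ^ m * ‖aeval W fH‖ ≤
      ‖aeval (Fin.snoc z (ε : ℂ) : Fin (d + 1) → ℂ) fH‖ := by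
    intro ε hε
    refine pow_mul_norm_aeval_le hH _ _ hδ fun s hs => ?_
    convert aeval_snoc_ne_zero_of_stable_of_pos hH hspec hst
      (hball (y := s) (by simpa using hs)) hε using 3
    ext j
    induction j using Fin.lastCases <;> simp [hWdef]
  have hlim : δ ^ m * ‖aeval W fH‖ ≤
      ‖aeval (Fin.snoc z ((0 : ℝ) : ℂ) : Fin (d + 1) → ℂ) fH‖ := by
    have hcl : IsClosed {ε : ℝ | δ ^ m * ‖aeval W fH‖ ≤
        ‖aeval (Fin.snoc z (ε : ℂ) : Fin (d + 1) → ℂ) fH‖} :=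
      isClosed_le continuous_const ((continuous_aeval_complex_s11 fH).comp
        (continuous_const.finSnoc Complex.continuous_ofReal)).norm
    refine hcl.closure_subset_iff.2 hbound ?_
    rw [closure_Ioi]
    exact Set.self_mem_Ici
  rw [Complex.ofReal_zero] at hlim
  exact norm_pos_iff.1 ((mul_pos (pow_pos hδ m) (norm_pos_iff.2 hW)).trans_le hlim)

theorem MvPolynomial.aeval_snoc_ofReal_ne_zero_of_stable (hf : f ≠ 0)
    (hm : f.totalDegree = m) (hH : fH.IsHomogeneous m)
    (hspec : ∀ z : Fin d → ℝ, eval (Fin.snoc z 1) fH = eval z f)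
    (hst : ∀ z : Fin d → ℂ, (∀ j, 0 < (z j).im) → aeval z f ≠ 0)
    {z : Fin d → ℂ} (hz : ∀ j, 0 < (z j).im) (ε : ℝ) :
    aeval (Fin.snoc z (ε : ℂ) : Fin (d + 1) → ℂ) fH ≠ 0 := by
  rcases lt_trichotomy ε 0 with hε | rfl | hε
  · have h := aeval_snoc_ne_zero_of_stable_of_pos hH hspec hst
      (z := fun j => -starRingEnd ℂ (z j)) (fun j => by simpa using hz j) (neg_pos.2 hε)
    refine aeval_ne_zero_of_smul hH (c := -1) fun h0 => h ?_
    rw [← map_eq_zero (starRingEnd ℂ), ← aeval_conj] at h0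
    convert h0 using 3
    ext j
    induction j using Fin.lastCases <;> simp
  · rw [Complex.ofReal_zero]
    exact aeval_snoc_zero_ne_zero_of_stable hf hm hH hspec hst hz
  · exact aeval_snoc_ne_zero_of_stable_of_pos hH hspec hst hz hε

theorem MvPolynomial.homogenization_hyperbolic_of_stable (hf : f ≠ 0)
    (hm : f.totalDegree = m) (hH : fH.IsHomogeneous m)
    (hspec : ∀ z : Fin d → ℝ, eval (Fin.snoc z 1) fH = eval z f)
    (hst : ∀ z : Fin d → ℂ, (∀ j, 0 < (z j).im) → aeval z f ≠ 0)
    {v : Fin d → ℝ} (hv : ∀ j, 0 < v j) (y : Fin (d + 1) → ℝ) :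
    aeval (fun j => ((Fin.snoc v 0 : Fin (d + 1) → ℝ) j : ℂ) + Complex.I * (y j : ℂ)) fH ≠ 0 := by
  refine aeval_ne_zero_of_smul hH (c := Complex.I) ?_
  convert aeval_snoc_ofReal_ne_zero_of_stable hf hm hH hspec hst
    (z := fun j => Complex.I * v j - y j.castSucc) (fun j => by simpa using hv j)
    (-y (Fin.last d)) using 3
  ext j
  induction j using Fin.lastCases with
  | last =>
    simp only [Pi.smul_apply, Fin.snoc_last, smul_eq_mul]
    push_cast
    linear_combination (y (Fin.last d) : ℂ) * Complex.I_sq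
  | cast j =>
    simp only [Pi.smul_apply, Fin.snoc_castSucc, smul_eq_mul]
    linear_combination (y j.castSucc : ℂ) * Complex.I_sq

theorem MvPolynomial.stable_of_homogenization_hyperbolic (hH : fH.IsHomogeneous m)
    (hspec : ∀ z : Fin d → ℝ, eval (Fin.snoc z 1) fH = eval z f)
    (hhyp : ∀ v : Fin d → ℝ, (∀ j, 0 < v j) → ∀ y : Fin (d + 1) → ℝ,
      aeval (fun j => ((Fin.snoc v 0 : Fin (d + 1) → ℝ) j : ℂ) + Complex.I * (y j : ℂ)) fH ≠ 0)
    {z : Fin d → ℂ} (hz : ∀ j, 0 < (z j).im) : aeval z f ≠ 0 := by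
  rw [← aeval_snoc_one hspec]
  convert aeval_smul_ne_zero hH Complex.I_ne_zero
    (hhyp (fun j => (z j).im) hz (Fin.snoc (fun j => -(z j).re) (-1))) using 3
  ext j
  induction j using Fin.lastCases with
  | last =>
    simp only [Pi.smul_apply, Fin.snoc_last, smul_eq_mul]
    push_cast
    linear_combination Complex.I_sq
  | cast j =>
    simp only [Pi.smul_apply, Fin.snoc_castSucc, smul_eq_mul]
    conv_lhs => rw [← Complex.re_add_im (z j)]
    push_cast
    linear_combination ((z j).re : ℂ) * Complex.I_sq

theorem MvPolynomial.stable_of_hyperbolic {σ : Type*} {p : MvPolynomial σ ℝ}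
    (hp : p.IsHomogeneous m)
    (hhyp : ∀ w : σ → ℝ, (∀ j, 0 < w j) → ∀ y : σ → ℝ,
      aeval (fun j => (w j : ℂ) + Complex.I * (y j : ℂ)) p ≠ 0)
    {z : σ → ℂ} (hz : ∀ j, 0 < (z j).im) : aeval z p ≠ 0 := by
  convert aeval_smul_ne_zero hp Complex.I_ne_zero
    (hhyp (fun j => (z j).im) hz fun j => -(z j).re) using 3
  ext j
  simp only [Pi.smul_apply, smul_eq_mul]
  conv_lhs => rw [← Complex.re_add_im (z j)]
  push_cast
  linear_combination ((z j).re : ℂ) * Complex.I_sq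

theorem MvPolynomial.stable_of_homogenization_stable (hH : fH.IsHomogeneous m)
    (hspec : ∀ z : Fin d → ℝ, eval (Fin.snoc z 1) fH = eval z f)
    (hst : ∀ z : Fin (d + 1) → ℂ, (∀ j, 0 < (z j).im) → aeval z fH ≠ 0)
    {z : Fin d → ℂ} (hz : ∀ j, 0 < (z j).im) : aeval z f ≠ 0 := by
  rw [← aeval_snoc_one hspec]
  have hnear : ∀ᶠ ε : ℝ in nhds 0, ∀ j, 0 < ((1 + ε * Complex.I) * z j).im := by
    refine Filter.eventually_all.2 fun j => ?_
    have hc : Continuous fun ε : ℝ => ((1 + ε * Complex.I) * z j).im := by fun_prop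
    exact hc.continuousAt.eventually_const_lt (by simpa using hz j)
  obtain ⟨δ, hδ, hball⟩ := Metric.eventually_nhds_iff.1 hnear
  have hε := hball (y := δ / 2) (by
    rw [Real.dist_eq, sub_zero, abs_of_pos (half_pos hδ)]
    exact half_lt_self hδ)
  refine aeval_ne_zero_of_smul hH (c := 1 + (δ / 2 : ℝ) * Complex.I) (hst _ fun j => ?_)
  induction j using Fin.lastCases with
  | last => simpa using hδ
  | cast j => simpa only [Pi.smul_apply, Fin.snoc_castSucc, smul_eq_mul] using hε j

theorem MvPolynomial.eval_pos_of_coeff_nonneg {σ : Type*} {f : MvPolynomial σ ℝ} (hf : f ≠ 0)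
    (hc : ∀ e, 0 ≤ f.coeff e) {x : σ → ℝ} (hx : ∀ j, 0 < x j) : 0 < eval x f := by
  rw [eval_eq]
  refine Finset.sum_pos (fun e he => mul_pos ?_ ?_) (support_nonempty.2 hf)
  · exact lt_of_le_of_ne (hc e) (mem_support_iff.1 he).symm
  · exact Finset.prod_pos fun i _ => pow_pos (hx i) _

theorem MvPolynomial.eval_homogenization_ne_zero (hf : f ≠ 0) (hH : fH.IsHomogeneous m)
    (hspec : ∀ z : Fin d → ℝ, eval (Fin.snoc z 1) fH = eval z f)
    (hc : ∀ e, 0 ≤ f.coeff e) {x : Fin (d + 1) → ℝ} (hx : ∀ j, 0 < x j) :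
    eval x fH ≠ 0 := by
  have h := aeval_snoc_of_ne_zero hH hspec (Fin.init x) (hx (Fin.last d)).ne'
  rw [aeval_eq_eval, aeval_eq_eval, Fin.snoc_init_self] at h
  rw [h]
  refine mul_ne_zero (pow_ne_zero _ (hx _).ne') (eval_pos_of_coeff_nonneg hf hc fun j => ?_).ne'
  exact mul_pos (inv_pos.2 (hx _)) (hx j.castSucc)

theorem MvPolynomial.exists_hyperbolic_of_stable (hf : f ≠ 0)
    (hm : f.totalDegree = m) (hH : fH.IsHomogeneous m)
    (hspec : ∀ z : Fin d → ℝ, eval (Fin.snoc z 1) fH = eval z f)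
    (hst : ∀ z : Fin d → ℂ, (∀ j, 0 < (z j).im) → aeval z f ≠ 0) :
    ∃ w : Fin (d + 1) → ℝ, w ≠ 0 ∧ (∀ j, 0 ≤ w j) ∧ ∀ y : Fin (d + 1) → ℝ,
      aeval (fun j => (w j : ℂ) + Complex.I * (y j : ℂ)) fH ≠ 0 := by
  rcases Nat.eq_zero_or_pos d with rfl | hd
  · have hm0 : m = 0 := by
      rw [← hm]
      exact Nat.le_zero.1 (isHomogeneous_of_isEmpty _ _ f).totalDegree_le
    subst hm0
    obtain ⟨w, hw⟩ := exists_eval_snoc_zero_ne_zero hf hm hH hspec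
    have hC := totalDegree_eq_zero_iff_eq_C.1 ((totalDegree_zero_iff_isHomogeneous _).2 hH)
    rw [hC, eval_C] at hw
    refine ⟨1, one_ne_zero, fun _ => zero_le_one, fun y => ?_⟩
    rw [hC, aeval_C]
    simpa only [Complex.coe_algebraMap, ne_eq, Complex.ofReal_eq_zero] using hw
  · refine ⟨Fin.snoc 1 0, fun h => ?_, fun j => ?_,
      homogenization_hyperbolic_of_stable hf hm hH hspec hst fun _ => one_pos⟩
    · have h0 := congrFun h (Fin.castSucc ⟨0, hd⟩)
      rw [Fin.snoc_castSucc] at h0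
      exact one_ne_zero h0
    · induction j using Fin.lastCases <;> simp

end Homogenization

/-- **Proposition (homogenization).**
Let `f` be a nonzero real polynomial of total degree `m` in `z_1,…,z_d` and let `f_H`
be its homogenization, the homogeneous polynomial of degree `m` in `d+1` variables with
`f_H(z,1) = f(z)`.  Then `f` is stable iff `f_H` is hyperbolic in every direction
`(v,0)` with all `v_j > 0`.  If moreover `f` has nonnegative coefficients, then the
following are equivalent: (i) `f` is stable; (ii) `f_H` is stable; (iii) `f_H` is
hyperbolic with respect to some nonzero vector in the closed nonnegative orthant;
(iv) `f_H` is hyperbolic with respect to every vector in the open positive orthant. -/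
theorem stmt11 (d m : ℕ) (f : MvPolynomial (Fin d) ℝ) (hf : f ≠ 0)
    (hm : f.totalDegree = m)
    (fH : MvPolynomial (Fin (d + 1)) ℝ) (hH : fH.IsHomogeneous m)
    (hspec : ∀ z : Fin d → ℝ,
      MvPolynomial.eval (Fin.snoc z 1) fH = MvPolynomial.eval z f) :
    ((∀ z : Fin d → ℂ, (∀ j, 0 < (z j).im) → MvPolynomial.aeval z f ≠ 0) ↔
      (∀ v : Fin d → ℝ, (∀ j, 0 < v j) →
        ∀ y : Fin (d + 1) → ℝ,
          MvPolynomial.aeval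
            (fun j => ((Fin.snoc v 0 : Fin (d + 1) → ℝ) j : ℂ) + Complex.I * (y j : ℂ))
            fH ≠ 0)) ∧
    ((∀ mo, 0 ≤ f.coeff mo) →
      List.TFAE [
        (∀ z : Fin d → ℂ, (∀ j, 0 < (z j).im) → MvPolynomial.aeval z f ≠ 0),
        (∀ z : Fin (d + 1) → ℂ, (∀ j, 0 < (z j).im) → MvPolynomial.aeval z fH ≠ 0),
        (∃ w : Fin (d + 1) → ℝ, w ≠ 0 ∧ (∀ j, 0 ≤ w j) ∧
          ∀ y : Fin (d + 1) → ℝ,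
            MvPolynomial.aeval (fun j => (w j : ℂ) + Complex.I * (y j : ℂ)) fH ≠ 0),
        (∀ w : Fin (d + 1) → ℝ, (∀ j, 0 < w j) →
          ∀ y : Fin (d + 1) → ℝ,
            MvPolynomial.aeval (fun j => (w j : ℂ) + Complex.I * (y j : ℂ)) fH ≠ 0)]) := by
  refine ⟨⟨fun hst v hv y =>
      MvPolynomial.homogenization_hyperbolic_of_stable hf hm hH hspec hst hv y,
    fun hhyp z hz => MvPolynomial.stable_of_homogenization_hyperbolic hH hspec hhyp hz⟩,
    fun hc => ?_⟩
  tfae_have 1 → 3 := MvPolynomial.exists_hyperbolic_of_stable hf hm hH hspec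
  tfae_have 3 → 4 := by
    rintro ⟨w, -, hw0, hw⟩ a ha y
    exact MvPolynomial.hyperbolic_of_eval_ray_ne_zero hH hw (fun ρ hρ =>
      MvPolynomial.eval_homogenization_ne_zero hf hH hspec hc fun j =>
        add_pos_of_pos_of_nonneg (ha j) (mul_nonneg hρ (hw0 j))) y
  tfae_have 4 → 2 := fun h z hz => MvPolynomial.stable_of_hyperbolic hH h hz
  tfae_have 2 → 1 := fun h z hz => MvPolynomial.stable_of_homogenization_stable hH hspec h hz
  tfae_finish
end

section
/- Van der Waerden inequality: let A be an n × n doubly stochastic matrix, i.e., a real matrix with nonnegative entries all of whose row sums and column sums equal 1. Then the permanent of A satisfies Per(A) := Σ_{σ ∈ S_n} Π_{i=1}^n a_{i,σ(i)} ≥ n!/n^n. -/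
open Polynomial in
/-- If all roots of a real polynomial of degree `n + 1` are negative reals and the polynomial is
bounded below by `c * t` for positive `t`, then its linear coefficient is at least
`c * (n / (n + 1)) ^ n`. -/
lemma Polynomial.Splits.mul_pow_le_coeff_one {n : ℕ} (hn : n ≠ 0) {R : ℝ[X]} (hR : R.Splits)
    (hdeg : R.natDegree = n + 1) (hroots : ∀ w ∈ R.roots, w < 0) {c : ℝ} (hc : 0 < c)
    (hlow : ∀ t, 0 < t → c * t ≤ R.eval t) :
    c * ((n : ℝ) / (n + 1)) ^ n ≤ R.coeff 1 := by
  have hn' : (0 : ℝ) < n := by positivity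
  have hcard : R.roots.card = n + 1 := by rw [← hR.natDegree_eq_card_roots, hdeg]
  have hR0 : R ≠ 0 := by rintro rfl; simp at hdeg
  have hne : R.eval 0 ≠ 0 := fun h => lt_irrefl _ (hroots 0 ((mem_roots hR0).2 h))
  set s : ℝ := (R.roots.map fun w => -w⁻¹).sum with hs
  have hcoeff : R.coeff 1 = R.eval 0 * s := by
    have h := hR.eval_derivative_eq_eval_mul_sum hne
    rw [← coeff_zero_eq_eval_zero, coeff_derivative] at h
    simpa [hs, inv_neg] using h
  have heval (t : ℝ) : R.eval t = R.eval 0 * (R.roots.map fun w => 1 + t * -w⁻¹).prod := by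
    rw [hR.eval_eq_prod_roots t, hR.eval_eq_prod_roots 0, mul_assoc, ← Multiset.prod_map_mul]
    congr 2
    refine Multiset.map_congr rfl fun w hw => ?_
    have := (hroots w hw).ne
    field_simp
    ring
  have hspos : 0 < s := by
    obtain ⟨w, hw⟩ := Multiset.card_pos_iff_exists_mem.1 (by omega : 0 < R.roots.card)
    refine lt_of_lt_of_le ?_ (Multiset.single_le_sum ?_ _ (Multiset.mem_map_of_mem _ hw))
    · simpa using hroots w hw
    · intro x hx
      obtain ⟨v, hv, rfl⟩ := Multiset.mem_map.1 hx
      simpa using (hroots v hv).le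
  have hfac {t : ℝ} (ht : 0 < t) : ∀ w ∈ R.roots, 0 ≤ 1 + t * -w⁻¹ := fun w hw => by
    have : 0 < -w⁻¹ := by simpa using hroots w hw
    positivity
  have h0 : 0 < R.eval 0 := by
    have h1 := hlow 1 one_pos
    rw [heval 1] at h1
    refine pos_of_mul_pos_left (lt_of_lt_of_le (by positivity) h1) ?_
    refine Multiset.prod_nonneg fun x hx => ?_
    obtain ⟨v, hv, rfl⟩ := Multiset.mem_map.1 hx
    exact hfac one_pos v hv
  set t : ℝ := (n + 1) / (n * s) with ht
  set M : ℝ := (n + 1) / n with hM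
  have htpos : 0 < t := by positivity
  have hMpos : 0 < M := by positivity
  have hprod : (R.roots.map fun w => 1 + t * -w⁻¹).prod ≤ M ^ (n + 1) := by
    calc (R.roots.map fun w => 1 + t * -w⁻¹).prod
        ≤ (R.roots.map fun w => M * Real.exp ((1 + t * -w⁻¹) / M - 1)).prod := by
          refine Multiset.prod_map_le_prod_map₀ _ _ (hfac htpos) fun w _ => ?_
          have := Real.add_one_le_exp ((1 + t * -w⁻¹) / M - 1)
          calc 1 + t * -w⁻¹ = M * ((1 + t * -w⁻¹) / M - 1 + 1) := by
                rw [sub_add_cancel, mul_div_cancel₀ _ hMpos.ne']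
            _ ≤ _ := by gcongr
      _ = M ^ (n + 1) * Real.exp (R.roots.map fun w => (1 + t * -w⁻¹) / M - 1).sum := by
          rw [Multiset.prod_map_mul, Real.exp_multiset_sum, Multiset.map_map]
          simp [hcard, pow_succ']
      _ = M ^ (n + 1) := by
          have : (R.roots.map fun w => (1 + t * -w⁻¹) / M - 1).sum
              = (n + 1) * (1 / M - 1) + t / M * s := by
            rw [hs, ← Multiset.sum_map_mul_left]
            have : (n + 1 : ℝ) * (1 / M - 1) = (R.roots.map fun _ => 1 / M - 1).sum := by
              rw [Multiset.map_const', hcard, Multiset.sum_replicate, nsmul_eq_mul]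
              push_cast
              rfl
            rw [this, ← Multiset.sum_map_add]
            congr 1
            refine Multiset.map_congr rfl fun w _ => ?_
            ring
          rw [this, ht, hM]
          have : ((n : ℝ) + 1) * (1 / ((n + 1) / n) - 1)
            + (n + 1) / (n * s) / ((n + 1) / n) * s = 0 := by field_simp; ring
          rw [this]; simp
  have key : c * t ≤ R.eval 0 * M ^ (n + 1) :=
    (hlow t htpos).trans (by rw [heval t]; gcongr)
  rw [hcoeff]
  have e1 : c * ((n : ℝ) / (n + 1)) ^ n = c * t * (s / M ^ (n + 1)) := by
    rw [ht, hM, pow_succ, div_pow, div_pow]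
    field_simp
  have e2 : R.eval 0 * s = R.eval 0 * M ^ (n + 1) * (s / M ^ (n + 1)) := by field_simp
  rw [e1, e2]
  gcongr

/-- A real multivariate polynomial is strictly stable if it has no zeros in the closed right
half-space except possibly on its distinguished boundary. -/
def MvPolynomial.IsStrictlyStable {n : ℕ} (p : MvPolynomial (Fin n) ℝ) : Prop :=
  ∀ z : Fin n → ℂ, (∀ j, 0 ≤ (z j).re) → (∃ j, 0 < (z j).re) → aeval z p ≠ 0

namespace MvPolynomial

variable {n : ℕ}

/-- The univariate polynomial obtained from `p` by specializing all variables but the first. -/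
noncomputable def slice {K : Type*} [CommRing K] [Algebra ℝ K] (p : MvPolynomial (Fin (n + 1)) ℝ)
    (z : Fin n → K) : Polynomial K :=
  (finSuccEquiv ℝ n p).map (aeval z : MvPolynomial (Fin n) ℝ →ₐ[ℝ] K).toRingHom

section slice

variable {K : Type*} [CommRing K] [Algebra ℝ K] (p : MvPolynomial (Fin (n + 1)) ℝ) (z : Fin n → K)

lemma coeff_slice (i : ℕ) :
    (p.slice z).coeff i = aeval z ((finSuccEquiv ℝ n p).coeff i) := by
  simp [slice, Polynomial.coeff_map]

lemma eval_slice (t : K) :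
    (p.slice z).eval t = aeval (Fin.cons t z : Fin (n + 1) → K) p := by
  induction p using MvPolynomial.induction_on with
  | C a => simp [slice, finSuccEquiv_apply]
  | add p q hp hq => simpa [slice] using congrArg₂ (· + ·) hp hq
  | mul_X p j hp =>
    have : (p * X j).slice z = p.slice z * (X j : MvPolynomial (Fin (n + 1)) ℝ).slice z := by
      simp [slice]
    rw [this, Polynomial.eval_mul, hp]
    refine Fin.cases ?_ (fun j => ?_) j <;> simp [slice, finSuccEquiv_X_zero, finSuccEquiv_X_succ]

lemma map_slice (x : Fin n → ℝ) :
    (p.slice x).map (algebraMap ℝ ℂ) = p.slice (fun j => (x j : ℂ)) := by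
  ext i
  rw [Polynomial.coeff_map, coeff_slice, coeff_slice, ← aeval_algebraMap_apply]
  rfl

end slice

variable {p : MvPolynomial (Fin (n + 1)) ℝ}

lemma aeval_smul_of_isHomogeneous_s19 {σ K : Type*} [CommRing K] [Algebra ℝ K] {p : MvPolynomial σ ℝ}
    {d : ℕ} (hp : p.IsHomogeneous d) (c : K) (z : σ → K) :
    aeval (c • z) p = c ^ d * aeval z p := by
  rw [aeval_def, aeval_def, eval₂_eq, eval₂_eq, Finset.mul_sum]
  refine Finset.sum_congr rfl fun m hm => ?_
  have hd : ∑ i ∈ m.support, m i = d := by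
    simpa [Finsupp.weight_apply, Finsupp.sum] using hp (mem_support_iff.1 hm)
  simp only [Pi.smul_apply, smul_eq_mul, mul_pow, Finset.prod_mul_distrib,
    Finset.prod_pow_eq_pow_sum, hd]
  ring

lemma IsStrictlyStable.natDegree_slice (hs : p.IsStrictlyStable) (hp : p.IsHomogeneous (n + 1))
    (z : Fin n → ℂ) : (p.slice z).natDegree = n + 1 := by
  have hlt {i : ℕ} (hi : n + 1 < i) : (finSuccEquiv ℝ n p).coeff i = 0 := by
    ext m
    rw [finSuccEquiv_coeff_coeff, coeff_zero]
    refine hp.coeff_eq_zero ?_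
    rw [Finsupp.degree_eq_sum, Fin.sum_univ_succ]
    simp
    omega
  have hzero {i : ℕ} (hi : i < n + 1) : (p.slice (0 : Fin n → ℂ)).coeff i = 0 := by
    have h := aeval_smul_of_isHomogeneous_s19
      (hp.finSuccEquiv_coeff_isHomogeneous i (n + 1 - i) (by omega)) (0 : ℂ) 0
    rw [coeff_slice]
    rwa [zero_smul, zero_pow (by omega), zero_mul] at h
  have htop : (p.slice z).coeff (n + 1) = (p.slice (0 : Fin n → ℂ)).coeff (n + 1) := by
    have h := aeval_smul_of_isHomogeneous_s19
      (hp.finSuccEquiv_coeff_isHomogeneous (n + 1) 0 (by omega)) (0 : ℂ) z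
    rw [coeff_slice, coeff_slice, ← zero_smul ℂ z, h]
    simp
  have hle (z : Fin n → ℂ) : (p.slice z).natDegree ≤ n + 1 :=
    Polynomial.natDegree_le_iff_coeff_eq_zero.2 fun i hi => by rw [coeff_slice, hlt hi, map_zero]
  refine Polynomial.natDegree_eq_of_le_of_coeff_ne_zero (hle z) ?_
  have h := hs (Fin.cons 1 0) (fun j => by refine Fin.cases ?_ (fun _ => ?_) j <;> simp) ⟨0, by simp⟩
  rw [← eval_slice, Polynomial.eval_eq_sum_range' (Nat.lt_succ_of_le (hle 0)),
    Finset.sum_range_succ, Finset.sum_eq_zero fun i hi => by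
      rw [hzero (Finset.mem_range.1 hi), zero_mul]] at h
  rw [htop]
  simpa using h

lemma IsStrictlyStable.coeff_one (hs : p.IsStrictlyStable) (hp : p.IsHomogeneous (n + 1)) :
    ((finSuccEquiv ℝ n p).coeff 1).IsStrictlyStable := by
  intro z hz hz'
  rw [← coeff_slice]
  have hroot (w : ℂ) (hw : 0 ≤ w.re) : (p.slice z).eval w ≠ 0 := by
    rw [eval_slice]
    refine hs _ (fun j => Fin.cases (by simpa) (by simpa using hz) j) ?_
    exact hz'.imp' Fin.succ (by simp)
  have hsplit := IsAlgClosed.splits (p.slice z)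
  have h0 := hroot 0 (by simp)
  have h := hsplit.eval_derivative_eq_eval_mul_sum h0
  rw [← Polynomial.coeff_zero_eq_eval_zero, Polynomial.coeff_derivative] at h
  have hdeg := hs.natDegree_slice hp z
  have hne : p.slice z ≠ 0 := by intro h; simp [h] at hdeg
  have hneg {w : ℂ} (hw : w ∈ (p.slice z).roots) : 0 < (1 / (0 - w)).re := by
    have hw0 : w.re < 0 := by
      by_contra! hcon
      exact hroot w hcon ((Polynomial.mem_roots hne).1 hw)
    rw [one_div, Complex.inv_re]
    refine div_pos (by simpa using hw0) (Complex.normSq_pos.2 ?_)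
    rintro h
    have : w = 0 := by simpa using h
    simp [this] at hw0
  have hsum : 0 < ((p.slice z).roots.map fun w => 1 / (0 - w)).sum.re := by
    have hre : ((p.slice z).roots.map fun w => 1 / (0 - w)).sum.re
        = ((p.slice z).roots.map fun w => (1 / (0 - w)).re).sum := by
      have h := map_multiset_sum Complex.reAddGroupHom
        ((p.slice z).roots.map fun w => 1 / (0 - w))
      rwa [Multiset.map_map] at h
    rw [hre]
    obtain ⟨w, hw⟩ := Multiset.card_pos_iff_exists_mem.1
      (by rw [← hsplit.natDegree_eq_card_roots, hdeg]; omega : 0 < (p.slice z).roots.card)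
    refine lt_of_lt_of_le (hneg hw) (Multiset.single_le_sum ?_ _
      (Multiset.mem_map_of_mem (fun w => (1 / (0 - w)).re) hw))
    intro x hx
    obtain ⟨v, hv, rfl⟩ := Multiset.mem_map.1 hx
    exact (hneg hv).le
  have hsum0 : ((p.slice z).roots.map fun w => 1 / (0 - w)).sum ≠ 0 := by
    intro h
    rw [h] at hsum
    simp at hsum
  intro hc
  simp only [zero_add, hc, zero_mul] at h
  exact mul_ne_zero h0 hsum0 h.symm

/-- Roots of the slices at positive points are negative reals. -/
lemma IsStrictlyStable.root_slice (hs : p.IsStrictlyStable) (hp : p.IsHomogeneous (n + 1))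
    (hn : n ≠ 0) {x : Fin n → ℝ} (hx : ∀ j, 0 < x j) {w : ℂ}
    (hw : (p.slice fun j => (x j : ℂ)).eval w = 0) : w.re < 0 ∧ w.im = 0 := by
  obtain ⟨m, rfl⟩ := Nat.exists_eq_succ_of_ne_zero hn
  by_cases hre : 0 ≤ w.re
  · refine absurd ?_ (hs (Fin.cons w fun j => (x j : ℂ)) (fun j => Fin.cases (by simpa)
      (fun j => by simpa using (hx j).le) j) ⟨Fin.succ 0, by simpa using hx 0⟩)
    rwa [← eval_slice]
  push Not at hre
  refine ⟨hre, ?_⟩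
  by_contra him
  have hlt : 0 < ‖w‖ + w.re := by
    have := Complex.abs_re_lt_norm.2 him
    rw [abs_of_neg hre] at this
    linarith
  have hcre : ((‖w‖ : ℂ) + starRingEnd ℂ w).re = ‖w‖ + w.re := by simp
  have hcw : ((‖w‖ : ℂ) + starRingEnd ℂ w) * w = ((‖w‖ : ℂ) * (w + ‖w‖)) := by
    rw [add_mul, mul_comm (starRingEnd ℂ w), Complex.mul_conj, Complex.normSq_eq_norm_sq]
    push_cast
    ring
  refine hs (((‖w‖ : ℂ) + starRingEnd ℂ w) • (Fin.cons w fun j => (x j : ℂ))) ?_ ?_ ?_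
  · refine fun j => Fin.cases ?_ (fun j => ?_) j
    · simp only [Pi.smul_apply, Fin.cons_zero, smul_eq_mul, hcw, Complex.re_ofReal_mul,
        Complex.add_re, Complex.ofReal_re]
      exact mul_nonneg (norm_nonneg _) (by linarith)
    · simp only [Pi.smul_apply, Fin.cons_succ, smul_eq_mul, Complex.re_mul_ofReal, hcre]
      exact (mul_pos hlt (hx j)).le
  · refine ⟨Fin.succ 0, ?_⟩
    simp only [Pi.smul_apply, Fin.cons_succ, smul_eq_mul, Complex.re_mul_ofReal, hcre]
    exact mul_pos hlt (hx 0)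
  · rw [aeval_smul_of_isHomogeneous_s19 hp, ← eval_slice, hw, mul_zero]

/-- Gurvits' capacity inequality for one step of partial differentiation. -/
lemma IsStrictlyStable.mul_prod_le_eval_coeff_one (hs : p.IsStrictlyStable)
    (hp : p.IsHomogeneous (n + 1)) {c : ℝ} (hc : 0 < c)
    (hcap : ∀ x : Fin (n + 1) → ℝ, (∀ j, 0 < x j) → c * ∏ j, x j ≤ eval x p)
    {x : Fin n → ℝ} (hx : ∀ j, 0 < x j) :
    c * ((n : ℝ) / (n + 1)) ^ n * ∏ j, x j ≤ eval x ((finSuccEquiv ℝ n p).coeff 1) := by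
  have hlow (t : ℝ) (ht : 0 < t) : c * (∏ j, x j) * t ≤ (p.slice x).eval t := by
    have h := hcap (Fin.cons t x) (fun j => Fin.cases (by simpa) (by simpa using hx) j)
    rw [eval_slice, aeval_eq_eval]
    simp only [Fin.prod_univ_succ, Fin.cons_zero, Fin.cons_succ] at h
    refine le_trans (le_of_eq ?_) h
    ring
  have hP : 0 < ∏ j, x j := Finset.prod_pos fun j _ => hx j
  have hdeg : (p.slice x).natDegree = n + 1 := by
    rw [← hs.natDegree_slice hp fun j => (x j : ℂ), ← map_slice, Polynomial.natDegree_map]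
  rw [← aeval_eq_eval, ← coeff_slice, mul_right_comm]
  obtain rfl | hn := eq_or_ne n 0
  · have h1 := hlow 1 one_pos
    have h0 : (p.slice x).coeff 0 = 0 := by
      have h := aeval_smul_of_isHomogeneous_s19
        (hp.finSuccEquiv_coeff_isHomogeneous 0 1 (by omega)) (0 : ℝ) x
      rw [coeff_slice, Subsingleton.elim x ((0 : ℝ) • x), h]
      simp
    rw [Polynomial.eval_eq_sum_range, hdeg] at h1
    simpa [Finset.sum_range_succ, h0] using h1
  have hR0 : p.slice x ≠ 0 := by intro h; simp [h] at hdeg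
  have hmap := IsAlgClosed.splits ((p.slice x).map (algebraMap ℝ ℂ))
  refine Polynomial.Splits.mul_pow_le_coeff_one hn ?_ hdeg ?_ (by positivity) hlow
  · refine Polynomial.Splits.of_splits_map (algebraMap ℝ ℂ) hmap fun w hw => ?_
    have hw' := Polynomial.isRoot_of_mem_roots hw
    rw [map_slice] at hw'
    obtain ⟨-, him⟩ := hs.root_slice hp hn hx hw'
    exact ⟨w.re, Complex.ext (by simp) (by simp [him])⟩
  · intro w hw
    have hw' := (Polynomial.isRoot_of_mem_roots hw).map (f := algebraMap ℝ ℂ)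
    rw [map_slice] at hw'
    simpa using (hs.root_slice hp hn hx hw').1

/-- Gurvits' capacity inequality. -/
lemma IsStrictlyStable.mul_factorial_le_coeff {n : ℕ} {p : MvPolynomial (Fin n) ℝ}
    (hs : p.IsStrictlyStable) (hp : p.IsHomogeneous n) {c : ℝ} (hc : 0 < c)
    (hcap : ∀ x : Fin n → ℝ, (∀ j, 0 < x j) → c * ∏ j, x j ≤ eval x p) :
    c * (n.factorial / (n : ℝ) ^ n) ≤ coeff (Finsupp.equivFunOnFinite.symm fun _ => 1) p := by
  induction n generalizing c with
  | zero =>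
    have h := hcap 0 (fun j => j.elim0)
    rw [eq_C_of_isEmpty p] at h ⊢
    simp only [eval_C] at h
    rw [Subsingleton.elim (Finsupp.equivFunOnFinite.symm fun _ => 1) (0 : Fin 0 →₀ ℕ), coeff_C]
    simpa using h
  | succ n ih =>
    have hfac : 0 < c * ((n : ℝ) / (n + 1)) ^ n := by
      obtain rfl | hn := eq_or_ne n 0
      · simpa
      · have : (0 : ℝ) < n := by positivity
        positivity
    have h := ih (hs.coeff_one hp) (hp.finSuccEquiv_coeff_isHomogeneous 1 n (by omega)) hfac
      fun x hx => hs.mul_prod_le_eval_coeff_one hp hc hcap hx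
    rw [finSuccEquiv_coeff_coeff] at h
    have hones : Finsupp.cons 1 (Finsupp.equivFunOnFinite.symm fun _ : Fin n => 1)
        = Finsupp.equivFunOnFinite.symm fun _ : Fin (n + 1) => 1 := by
      ext j
      refine Fin.cases ?_ (fun j => ?_) j <;> simp
    rw [hones] at h
    refine le_trans (le_of_eq ?_) h
    have : (n : ℝ) ^ n ≠ 0 := by
      obtain rfl | hn := eq_or_ne n 0 <;> simp_all
    rw [Nat.factorial_succ, div_pow]
    push_cast
    field_simp
    ring

end MvPolynomial

open MvPolynomial in
/-- The product of the row forms of `A`. -/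
noncomputable def Matrix.rowProd {n : ℕ} (A : Matrix (Fin n) (Fin n) ℝ) :
    MvPolynomial (Fin n) ℝ :=
  ∏ i, ∑ j, C (A i j) * X j

namespace Matrix

open MvPolynomial

variable {n : ℕ} (A : Matrix (Fin n) (Fin n) ℝ)

lemma rowProd_isHomogeneous : A.rowProd.IsHomogeneous n := by
  have h := IsHomogeneous.prod Finset.univ (fun i => ∑ j, C (A i j) * X j) (fun _ => 1)
    fun i _ => IsHomogeneous.sum Finset.univ _ 1 fun j _ => isHomogeneous_C_mul_X (A i j) j
  simpa [rowProd] using h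

lemma coeff_rowProd :
    coeff (Finsupp.equivFunOnFinite.symm fun _ => 1) A.rowProd
      = ∑ σ : Equiv.Perm (Fin n), ∏ i, A i (σ i) := by
  have hprod (f : Fin n → Fin n) : ∏ i, (C (A i (f i)) * X (f i) : MvPolynomial (Fin n) ℝ)
      = monomial (∑ i, Finsupp.single (f i) 1) (∏ i, A i (f i)) := by
    simp [monomial_sum_index, Finset.prod_mul_distrib, X]
  have hcount (f : Fin n → Fin n) (j : Fin n) :
      (∑ i, Finsupp.single (f i) 1 : Fin n →₀ ℕ) j = ({i | f i = j} : Finset (Fin n)).card := by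
    simp [Finsupp.finsetSum_apply, Finsupp.single_apply]
  rw [rowProd, Finset.prod_univ_sum, coeff_sum, Fintype.piFinset_univ]
  simp only [hprod, coeff_monomial]
  refine (Finset.sum_of_injOn (fun σ : Equiv.Perm (Fin n) => ⇑σ) DFunLike.coe_injective.injOn
    (fun _ _ => Finset.mem_coe.2 (Finset.mem_univ _)) ?_ ?_).symm
  · intro f _ hf
    refine if_neg fun h => hf ?_
    have hsurj : Function.Surjective f := fun j => by
      have hj := DFunLike.congr_fun h j
      rw [hcount] at hj
      obtain ⟨i, hi⟩ := Finset.card_pos.1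
        (by rw [hj]; simp : 0 < ({i | f i = j} : Finset (Fin n)).card)
      exact ⟨i, by simpa using hi⟩
    exact ⟨Equiv.ofBijective f (Finite.surjective_iff_bijective.1 hsurj), by simp, rfl⟩
  · intro σ _
    refine (if_pos ?_).symm
    ext j
    rw [hcount, Finsupp.equivFunOnFinite_symm_apply_apply, Finset.card_eq_one]
    exact ⟨σ.symm j, by ext; simp [Equiv.eq_symm_apply]⟩

lemma rowProd_isStrictlyStable (hA : ∀ i j, 0 < A i j) : A.rowProd.IsStrictlyStable := by
  rintro z hz ⟨k, hk⟩
  simp only [rowProd, map_prod, map_sum, map_mul, aeval_C, aeval_X, Complex.coe_algebraMap]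
  refine Finset.prod_ne_zero_iff.2 fun i _ h => ?_
  have hre := congrArg Complex.re h
  simp only [Complex.re_sum, Complex.re_ofReal_mul, Complex.zero_re] at hre
  exact (Finset.sum_pos' (fun j _ => mul_nonneg (hA i j).le (hz j))
    ⟨k, Finset.mem_univ k, mul_pos (hA i k) hk⟩).ne' hre

lemma prod_le_eval_rowProd (hpos : ∀ i j, 0 ≤ A i j) (hrow : ∀ i, ∑ j, A i j = 1)
    (hcol : ∀ j, ∑ i, A i j = 1) {x : Fin n → ℝ} (hx : ∀ j, 0 < x j) :
    ∏ j, x j ≤ eval x A.rowProd := by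
  simp only [rowProd, map_prod, map_sum, map_mul, eval_C, eval_X]
  calc ∏ j, x j = ∏ i, ∏ j, x j ^ A i j := by
        rw [Finset.prod_comm]
        refine Finset.prod_congr rfl fun j _ => ?_
        rw [← Real.rpow_sum_of_pos (hx j), hcol, Real.rpow_one]
    _ ≤ _ := Finset.prod_le_prod
        (fun i _ => Finset.prod_nonneg fun j _ => Real.rpow_nonneg (hx j).le _)
        fun i _ => Real.geom_mean_le_arith_mean_weighted _ _ _ (fun j _ => hpos i j) (hrow i)
          fun j _ => (hx j).le

lemma factorial_div_pow_le_of_pos (hpos : ∀ i j, 0 < A i j) (hrow : ∀ i, ∑ j, A i j = 1)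
    (hcol : ∀ j, ∑ i, A i j = 1) :
    (n.factorial : ℝ) / (n : ℝ) ^ n ≤ ∑ σ : Equiv.Perm (Fin n), ∏ i, A i (σ i) := by
  rw [← coeff_rowProd]
  simpa using (A.rowProd_isStrictlyStable hpos).mul_factorial_le_coeff A.rowProd_isHomogeneous
    one_pos fun x hx => by
      simpa using A.prod_le_eval_rowProd (fun i j => (hpos i j).le) hrow hcol hx

end Matrix

/-- **Van der Waerden inequality (Egorychev–Falikman theorem).**
If `A` is an `n × n` doubly stochastic matrix (nonnegative real entries, all row sums
and column sums equal to 1), then its permanent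
`Per(A) = ∑_{σ ∈ S_n} ∏_{i=1}^n a_{i,σ(i)}` satisfies `Per(A) ≥ n!/nⁿ`. -/
theorem stmt19 (n : ℕ) (A : Matrix (Fin n) (Fin n) ℝ)
    (hpos : ∀ i j, 0 ≤ A i j)
    (hrow : ∀ i, ∑ j, A i j = 1) (hcol : ∀ j, ∑ i, A i j = 1) :
    (n.factorial : ℝ) / (n : ℝ) ^ n ≤ ∑ σ : Equiv.Perm (Fin n), ∏ i, A i (σ i) := by
  obtain rfl | hn := eq_or_ne n 0
  · simp
  have hn' : (0 : ℝ) < n := by positivity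
  let B (ε : ℝ) : Matrix (Fin n) (Fin n) ℝ := fun i j => (1 - ε) * A i j + ε * (n : ℝ)⁻¹
  have hcont : Continuous fun ε => ∑ σ : Equiv.Perm (Fin n), ∏ i, B ε i (σ i) := by
    fun_prop
  have hlim := (hcont.tendsto 0).mono_left (nhdsWithin_le_nhds (s := Set.Ioi 0))
  have h0 : B 0 = A := by ext; simp [B]
  rw [h0] at hlim
  refine ge_of_tendsto hlim ?_
  filter_upwards [Ioo_mem_nhdsGT (zero_lt_one (α := ℝ))] with ε hε
  refine (B ε).factorial_div_pow_le_of_pos (fun i j => ?_) (fun i => ?_) fun j => ?_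
  · have := mul_nonneg (sub_nonneg.2 hε.2.le) (hpos i j)
    have := mul_pos hε.1 (inv_pos.2 hn')
    simp only [B]
    linarith
  · simp [B, Finset.sum_add_distrib, ← Finset.mul_sum, hrow]
    field_simp
    ring
  · simp [B, Finset.sum_add_distrib, ← Finset.mul_sum, hcol]
    field_simp
    ring
end
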